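/- Let Φ be a Young function such that Φ and its conjugate Φ̃ are of class Δ₂ ∩ Δ', assume ℳ is countably generated modulo μ-null sets, let {T(x)}_{x∈ℝ^N} be an N-dimensional dynamical system on Ω, let f satisfy (H₁)–(H₄), and let f_n be the regularized integrands. Let (ε_k) ⊆ (0,1] with ε_k → 0 and let v_k : Q×Ω → ℝ^N be measurable with sup_k ‖|v_k|‖_{Φ,Q×Ω} < ∞, whose components weakly stochastically 2-scale converge to the components of a measurable v : Q×Ω×ℝ^N → ℝ^N, ℤ^N-periodic in the last variable, with ‖|v|‖_{Φ,Q×Ω×Y} < ∞. Then there exists a constant C' ≥ 0 such that for every integer n ≥ 1, ∫_{Q×Ω×Y} f_n(x,ω,y,v(x,ω,y)) dx dμ(ω) dy − C'/n ≤ liminf_{k→∞} ∫_{Q×Ω} f(x, T(x/ε_k)ω, x/ε_k², v_k(x,ω)) dx dμ(ω). -/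

import Mathlib

open MeasureTheory Filter Topology ENNReal

noncomputable section

/-- Euclidean norm on `Fin N → ℝ`. -/
def enorm2 {N : ℕ} (v : Fin N → ℝ) : ℝ := Real.sqrt (∑ i, v i ^ 2)

/-- `Φ : [0,∞) → [0,∞)` is a Young function: continuous, convex, positive on `(0,∞)`,
with `Φ(t)/t → 0` as `t → 0⁺` and `Φ(t)/t → ∞` as `t → ∞` (so `Φ(0) = 0`). -/
def IsYoung (Φ : ℝ → ℝ) : Prop :=
  ContinuousOn Φ (Set.Ici 0) ∧ ConvexOn ℝ (Set.Ici 0) Φ ∧ Φ 0 = 0 ∧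
    (∀ t : ℝ, 0 < t → 0 < Φ t) ∧ (∀ t : ℝ, 0 ≤ t → 0 ≤ Φ t) ∧
    Tendsto (fun t => Φ t / t) (nhdsWithin 0 (Set.Ioi 0)) (nhds 0) ∧
    Tendsto (fun t => Φ t / t) atTop atTop

/-- The `Δ₂`-condition (at infinity). -/
def Delta2 (Φ : ℝ → ℝ) : Prop :=
  ∃ α : ℝ, 0 < α ∧ ∃ t₀ : ℝ, 0 ≤ t₀ ∧ ∀ t : ℝ, t₀ ≤ t → Φ (2 * t) ≤ α * Φ t

/-- The `Δ'`-condition (at infinity). -/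
def DeltaPrime (Φ : ℝ → ℝ) : Prop :=
  ∃ k : ℝ, 0 < k ∧ ∃ t₀ s₀ : ℝ, 0 ≤ t₀ ∧ 0 ≤ s₀ ∧
    ∀ t s : ℝ, t₀ ≤ t → s₀ ≤ s → Φ (t * s) ≤ k * Φ t * Φ s

/-- The conjugate Young function `Φ̃(t) = sup_{s ≥ 0} (st − Φ(s))`. -/
def conjY (Φ : ℝ → ℝ) (t : ℝ) : ℝ := sSup ((fun s => s * t - Φ s) '' Set.Ici 0)

/-- The Luxemburg norm `‖u‖_{Φ,X} = inf {δ > 0 : ∫_X Φ(|u|/δ) dν ≤ 1}` (`+∞` if no such `δ`). -/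
def luxNorm {X : Type*} [MeasurableSpace X] (Φ : ℝ → ℝ) (ν : Measure X) (u : X → ℝ) : ℝ≥0∞ :=
  sInf {d : ℝ≥0∞ | ∃ δ : ℝ, 0 < δ ∧ d = ENNReal.ofReal δ ∧
    (∫⁻ x, ENNReal.ofReal (Φ (|u x| / δ)) ∂ν) ≤ 1}

/-- An `N`-dimensional dynamical system on `Ω` preserving `μ`. -/
def IsDynSys {N : ℕ} {Ω : Type*} [MeasurableSpace Ω] (μ : Measure Ω)
    (T : (Fin N → ℝ) → Ω → Ω) : Prop :=
  T 0 = id ∧ (∀ x y : Fin N → ℝ, T (x + y) = T x ∘ T y) ∧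
    (∀ x : Fin N → ℝ, MeasurePreserving (T x) μ μ) ∧
    Measurable fun p : (Fin N → ℝ) × Ω => T p.1 p.2

/-- `ℤ^N`-periodicity. -/
def ZPeriodic {N : ℕ} (g : (Fin N → ℝ) → ℝ) : Prop :=
  ∀ (y : Fin N → ℝ) (k : Fin N → ℤ), g (y + fun i => (k i : ℝ)) = g y

/-- The unit cube `Y = [0,1]^N`. -/
def Ycube (N : ℕ) : Set (Fin N → ℝ) := Set.Icc 0 1

/-- `ℳ` is countably generated modulo `μ`-null sets. -/
def CountGenModNull {Ω : Type*} [MeasurableSpace Ω] (μ : Measure Ω) : Prop :=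
  ∃ S : ℕ → Set Ω, (∀ n, MeasurableSet (S n)) ∧
    ∀ A : Set Ω, MeasurableSet A →
      ∃ B : Set Ω, MeasurableSet[MeasurableSpace.generateFrom (Set.range S)] B ∧
        μ (symmDiff A B) = 0

/-- Weak stochastic two-scale convergence of `(u k)` to `u₀` along the sequence `(ε k)`. -/
def WeakStoch2Scale {N : ℕ} {Ω : Type*} [MeasurableSpace Ω] (μ : Measure Ω)
    (T : (Fin N → ℝ) → Ω → Ω) (Q : Set (Fin N → ℝ)) (ε : ℕ → ℝ)
    (u : ℕ → (Fin N → ℝ) → Ω → ℝ) (u₀ : (Fin N → ℝ) → Ω → (Fin N → ℝ) → ℝ) : Prop :=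
  ∀ φ : (Fin N → ℝ) → ℝ, ContDiff ℝ (⊤ : ℕ∞) φ → HasCompactSupport φ → tsupport φ ⊆ Q →
    ∀ ψ : Ω → ℝ, Measurable ψ → (∃ C : ℝ, ∀ ω, |ψ ω| ≤ C) →
      ∀ g : (Fin N → ℝ) → ℝ, Continuous g → ZPeriodic g →
        Tendsto
          (fun k => ∫ x in Q, (∫ ω, u k x ω * φ x * ψ (T ((ε k)⁻¹ • x) ω) *
              g (((ε k) ^ 2)⁻¹ • x) ∂μ))
          atTop
          (nhds (∫ x in Q, (∫ ω, (∫ y in Ycube N, u₀ x ω y * φ x * ψ ω * g y) ∂μ)))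



lemma young_mono {Φ : ℝ → ℝ} (h : IsYoung Φ) {s t : ℝ} (hs : 0 ≤ s) (hst : s ≤ t) : Φ s ≤ Φ t := by
  obtain ⟨_, hc, h0, _, hnn, _, _⟩ := h
  rcases hs.eq_or_lt with rfl | hs'
  · rw [h0]; exact hnn t hst
  have ht : 0 < t := hs'.trans_le hst
  have hc2 := hc.2
  have := @hc2 0 (Set.mem_Ici.2 le_rfl) t (Set.mem_Ici.2 ht.le) (1 - s / t) (s / t)
    (by rw [sub_nonneg, div_le_one ht]; exact hst) (by positivity) (by ring)
  simp only [smul_eq_mul, mul_zero, zero_add, h0] at this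
  rw [div_mul_cancel₀ _ ht.ne'] at this
  have h1 : s / t ≤ 1 := by rw [div_le_one ht]; exact hst
  nlinarith [hnn t ht.le]

lemma young_cont {Φ : ℝ → ℝ} (h : IsYoung Φ) : Continuous fun t : ℝ => Φ |t| :=
  h.1.comp_continuous continuous_abs fun t => abs_nonneg t

lemma enorm2_eq {N : ℕ} (v : Fin N → ℝ) : enorm2 v = ‖WithLp.toLp 2 v‖ := by
  simp [enorm2, EuclideanSpace.norm_eq]

lemma enorm2_nonneg {N : ℕ} (v : Fin N → ℝ) : 0 ≤ enorm2 v := Real.sqrt_nonneg _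

lemma enorm2_cont {N : ℕ} : Continuous (enorm2 : (Fin N → ℝ) → ℝ) := by
  unfold enorm2; fun_prop

lemma abs_le_enorm2 {N : ℕ} (v : Fin N → ℝ) (i : Fin N) : |v i| ≤ enorm2 v := by
  apply Real.abs_le_sqrt
  exact Finset.single_le_sum (f := fun i => v i ^ 2) (fun i _ => sq_nonneg _) (Finset.mem_univ i)

lemma enorm2_sub_le {N : ℕ} (v w : Fin N → ℝ) : enorm2 (v - w) ≤ enorm2 v + enorm2 w := by
  simp only [enorm2_eq, WithLp.toLp_sub]; exact norm_sub_le _ _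

lemma enorm2_smul {N : ℕ} (c : ℝ) (v : Fin N → ℝ) : enorm2 (c • v) = |c| * enorm2 v := by
  simp only [enorm2_eq, WithLp.toLp_smul, norm_smul, Real.norm_eq_abs]

lemma young_enorm_cont {N : ℕ} {Φ : ℝ → ℝ} (h : IsYoung Φ) :
    Continuous fun v : Fin N → ℝ => Φ (enorm2 v) := by
  have := (young_cont h).comp (enorm2_cont (N := N))
  simpa [Function.comp_def, abs_of_nonneg, enorm2_nonneg] using this

lemma delta2_two {Φ : ℝ → ℝ} (h : IsYoung Φ) (h2 : Delta2 Φ) :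
    ∃ A : ℝ, 0 ≤ A ∧ ∀ t, 0 ≤ t → Φ (2 * t) ≤ A * (1 + Φ t) := by
  obtain ⟨α, hα, t₀, ht₀, H⟩ := h2
  have hnn := h.2.2.2.2.1
  refine ⟨α + Φ (2 * t₀), add_nonneg hα.le (hnn _ (by positivity)), fun t ht => ?_⟩
  have h1 := hnn t ht
  have h3 := hnn (2 * t₀) (by positivity)
  rcases le_total t₀ t with h' | h'
  · have := H t h'
    nlinarith [mul_nonneg h3 h1]
  · have := young_mono h (s := 2 * t) (t := 2 * t₀) (by positivity) (by linarith)
    nlinarith [mul_nonneg h3 h1, mul_nonneg hα.le h1]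

lemma delta2_scale {Φ : ℝ → ℝ} (h : IsYoung Φ) (h2 : Delta2 Φ) (L : ℝ) (hL : 0 ≤ L) :
    ∃ A : ℝ, 0 ≤ A ∧ ∀ t, 0 ≤ t → Φ (L * t) ≤ A * (1 + Φ t) := by
  obtain ⟨A, hA, H⟩ := delta2_two h h2
  have hnn := h.2.2.2.2.1
  have key : ∀ m : ℕ, ∃ B : ℝ, 0 ≤ B ∧ ∀ t, 0 ≤ t → Φ (2 ^ m * t) ≤ B * (1 + Φ t) := by
    intro m
    induction m with
    | zero => exact ⟨1, zero_le_one, fun t ht => by simp⟩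
    | succ m ih =>
      obtain ⟨B, hB, hb⟩ := ih
      refine ⟨A * (1 + B), by positivity, fun t ht => ?_⟩
      have e : (2 : ℝ) ^ (m + 1) * t = 2 * (2 ^ m * t) := by ring
      rw [e]
      have h1 := H (2 ^ m * t) (by positivity)
      have h3 := hb t ht
      have h4 := hnn t ht
      calc _ ≤ _ := h1
        _ ≤ A * (1 + B * (1 + Φ t)) := by gcongr
        _ ≤ A * (1 + B) * (1 + Φ t) := by
          rw [mul_assoc]; apply mul_le_mul_of_nonneg_left _ hA; nlinarith
  obtain ⟨m, hm⟩ := pow_unbounded_of_one_lt L (by norm_num : (1:ℝ) < 2)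
  obtain ⟨B, hB, hb⟩ := key m
  refine ⟨B, hB, fun t ht => (young_mono h (by positivity) ?_).trans (hb t ht)⟩
  gcongr

lemma delta2_shift {Φ : ℝ → ℝ} (h : IsYoung Φ) (h2 : Delta2 Φ) :
    ∃ A : ℝ, 0 ≤ A ∧ ∀ t, 0 ≤ t → Φ (t + 1) ≤ A * (1 + Φ t) := by
  obtain ⟨A, hA, H⟩ := delta2_two h h2
  have hnn := h.2.2.2.2.1
  refine ⟨A + Φ 2, add_nonneg hA (hnn _ (by norm_num)), fun t ht => ?_⟩
  have h1 := hnn t ht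
  have h3 := hnn 2 (by norm_num)
  rcases le_total 1 t with h' | h'
  · have := young_mono h (s := t + 1) (t := 2 * t) (by positivity) (by linarith)
    have := H t ht
    nlinarith [mul_nonneg h3 h1]
  · have := young_mono h (s := t + 1) (t := 2) (by positivity) (by linarith)
    nlinarith [mul_nonneg h3 h1, mul_nonneg hA h1]

lemma young_superlin {Φ : ℝ → ℝ} (h : IsYoung Φ) (η : ℝ) (hη : 0 < η) :
    ∃ R : ℝ, 0 ≤ R ∧ ∀ t, 0 ≤ t → t ≤ R + η * Φ t := by
  have hnn := h.2.2.2.2.1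
  obtain ⟨R, hR⟩ := (h.2.2.2.2.2.2.eventually_ge_atTop (1 / η)).exists_forall_of_atTop
  refine ⟨max R 1, by positivity, fun t ht => ?_⟩
  have h1 := hnn t ht
  rcases le_total (max R 1) t with h' | h'
  · have htp : 0 < t := lt_of_lt_of_le one_pos ((le_max_right _ _).trans h')
    have := hR t ((le_max_left _ _).trans h')
    rw [div_le_div_iff₀ hη htp] at this
    have h4 : (0:ℝ) ≤ max R 1 := by positivity
    linarith
  · nlinarith [mul_nonneg hη.le h1]

lemma lux_bound {Φ : ℝ → ℝ} (h : IsYoung Φ) (h2 : Delta2 Φ) {X : Type*} [MeasurableSpace X]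
    (ν : Measure X) [IsFiniteMeasure ν] (S : ℝ≥0∞) (hS : S < ⊤) :
    ∃ C : ℝ, 0 ≤ C ∧ ∀ u : X → ℝ, Measurable u → (∀ x, 0 ≤ u x) → luxNorm Φ ν u ≤ S →
      Integrable (fun x => Φ (u x)) ν ∧ ∫ x, Φ (u x) ∂ν ≤ C := by
  have hnn := h.2.2.2.2.1
  set L : ℝ := S.toReal + 1 with hL
  have hLp : 0 < L := by positivity
  obtain ⟨A, hA, H⟩ := delta2_scale h h2 L hLp.le
  refine ⟨A * (ν.real Set.univ + 1), by positivity, fun u hu hu0 hn => ?_⟩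
  have hlt : luxNorm Φ ν u < ENNReal.ofReal L := by
    refine hn.trans_lt ?_
    rw [ENNReal.lt_ofReal_iff_toReal_lt hS.ne]; linarith
  obtain ⟨d, ⟨δ, hδ, rfl, hd⟩, hdL⟩ := sInf_lt_iff.1 hlt
  have hδL : δ < L := (ENNReal.ofReal_lt_ofReal_iff hLp).1 hdL
  have m1 : Measurable fun x => Φ (u x) := by
    have := (young_cont h).measurable.comp hu
    simpa [Function.comp_def, abs_of_nonneg, hu0] using this
  have m2 : Measurable fun x => Φ (u x / L) := by
    have := (young_cont h).measurable.comp (hu.div_const L)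
    have e : ∀ x, |u x / L| = u x / L := fun x => abs_of_nonneg (div_nonneg (hu0 x) hLp.le)
    simpa [Function.comp_def, e] using this
  have nn2 : ∀ x, 0 ≤ Φ (u x / L) := fun x => hnn _ (div_nonneg (hu0 x) hLp.le)
  have b1 : ∫⁻ x, ENNReal.ofReal (Φ (u x / L)) ∂ν ≤ 1 := by
    refine le_trans (lintegral_mono fun x => ENNReal.ofReal_le_ofReal ?_) hd
    rw [abs_of_nonneg (hu0 x)]
    apply young_mono h (div_nonneg (hu0 x) hLp.le)
    have := hu0 x
    gcongr
  have i2 : Integrable (fun x => Φ (u x / L)) ν := by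
    refine ⟨m2.aestronglyMeasurable, ?_⟩
    rw [hasFiniteIntegral_iff_ofReal (Eventually.of_forall nn2)]
    exact b1.trans_lt one_lt_top
  have b2 : ∫ x, Φ (u x / L) ∂ν ≤ 1 := by
    rw [integral_eq_lintegral_of_nonneg_ae (Eventually.of_forall nn2) m2.aestronglyMeasurable]
    exact ENNReal.toReal_le_of_le_ofReal zero_le_one (by simpa using b1)
  have i3 : Integrable (fun x => A * (1 + Φ (u x / L))) ν := ((integrable_const _).add i2).const_mul A
  have pw : ∀ x, Φ (u x) ≤ A * (1 + Φ (u x / L)) := fun x => by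
    have := H (u x / L) (div_nonneg (hu0 x) hLp.le)
    rwa [mul_div_cancel₀ _ hLp.ne'] at this
  have i1 : Integrable (fun x => Φ (u x)) ν := by
    refine i3.mono' m1.aestronglyMeasurable (Eventually.of_forall fun x => ?_)
    rw [Real.norm_of_nonneg (hnn _ (hu0 x))]; exact pw x
  refine ⟨i1, (integral_mono i1 i3 pw).trans ?_⟩
  rw [integral_const_mul, integral_add (integrable_const _) i2]
  simp only [integral_const, smul_eq_mul, mul_one]
  gcongr


lemma ycube_ae (N : ℕ) : ZSpan.fundamentalDomain (Pi.basisFun ℝ (Fin N)) =ᵐ[volume] Ycube N := by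
  rw [ZSpan.fundamentalDomain_pi_basisFun]
  exact Measure.univ_pi_Ico_ae_eq_Icc (μ := fun _ => volume) (f := fun _ : Fin N => (0:ℝ)) (g := fun _ => 1)

lemma ycube_vol (N : ℕ) : volume (Ycube N) = 1 := by
  simp [Ycube, Real.volume_Icc_pi]

open scoped Pointwise in
lemma ycube_shift {N : ℕ} (g : (Fin N → ℝ) → ℝ) (hp : ZPeriodic g) (c : Fin N → ℝ) :
    ∫ s in Ycube N, g (c + s) = ∫ s in Ycube N, g s := by
  rw [← setIntegral_congr_set (ycube_ae N), ← setIntegral_congr_set (ycube_ae N)]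
  set b := Pi.basisFun ℝ (Fin N)
  have h1 := ZSpan.isAddFundamentalDomain' b (volume : Measure (Fin N → ℝ))
  have h2 := h1.vadd_of_comm c
  have hinv : ∀ (l : (Submodule.span ℤ (Set.range b)).toAddSubgroup) (x : Fin N → ℝ), g (l +ᵥ x) = g x := by
    rintro ⟨l, hl⟩ x
    obtain ⟨k, hk⟩ : ∃ k : Fin N → ℤ, l = fun i => (k i : ℝ) := by
      have := (b.mem_span_iff_repr_mem ℤ l).1 hl
      choose k hk using this
      exact ⟨k, funext fun i => by simpa [b] using (hk i).symm⟩
    subst hk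
    change g ((fun i => (k i : ℝ)) + x) = g x
    rw [add_comm]; exact hp x k
  have : Countable (Submodule.span ℤ (Set.range b)).toAddSubgroup :=
    inferInstanceAs (Countable (Submodule.span ℤ (Set.range b)))
  have h3 := h2.setIntegral_eq h1 (f := g) hinv
  rw [← h3]
  have := (measurePreserving_add_left (volume : Measure (Fin N → ℝ)) c).setIntegral_preimage_emb
    (MeasurableEquiv.addLeft c).measurableEmbedding g (c +ᵥ ZSpan.fundamentalDomain b)
  rw [← this]
  congr 2
  ext x
  simp [Set.mem_vadd_set_iff_neg_vadd_mem]

lemma zper_reduce {N : ℕ} (y : Fin N → ℝ) : ∃ k : Fin N → ℤ, (y + fun i => (k i : ℝ)) ∈ Ycube N := by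
  refine ⟨fun i => -⌊y i⌋, ?_, ?_⟩ <;> intro i <;> simp
  · linarith [Int.floor_le (y i)]
  · linarith [Int.lt_floor_add_one (y i)]

lemma zper_bdd {N : ℕ} (g : (Fin N → ℝ) → ℝ) (hg : Continuous g) (hp : ZPeriodic g) :
    ∃ M : ℝ, 0 ≤ M ∧ ∀ y, |g y| ≤ M := by
  obtain ⟨M, hM⟩ := (isCompact_Icc (a := (0 : Fin N → ℝ)) (b := 1)).exists_bound_of_continuousOn hg.continuousOn
  refine ⟨max M 0, le_max_right _ _, fun y => ?_⟩
  obtain ⟨k, hk⟩ := zper_reduce y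
  rw [← hp y k]; exact (hM _ hk).trans (le_max_left _ _)

lemma averaging {N : ℕ} (φ : (Fin N → ℝ) → ℝ) (hφ : Continuous φ) (hφc : HasCompactSupport φ)
    (g : (Fin N → ℝ) → ℝ) (hg : Continuous g) (hp : ZPeriodic g) (δ : ℕ → ℝ)
    (hδ : ∀ k, δ k ∈ Set.Ioc (0 : ℝ) 1) (hδ0 : Tendsto δ atTop (nhds 0)) :
    Tendsto (fun k => ∫ x, φ x * g ((δ k)⁻¹ • x)) atTop
      (nhds ((∫ x, φ x) * ∫ y in Ycube N, g y)) := by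
  obtain ⟨M, hM0, hM⟩ := zper_bdd g hg hp
  obtain ⟨C, hC⟩ := hφc.exists_bound_of_continuous hφ
  have hC0 : 0 ≤ C := (norm_nonneg _).trans (hC 0)
  obtain ⟨R, hR⟩ := hφc.isBounded.subset_closedBall 0
  have hsupp : ∀ x, R < ‖x‖ → φ x = 0 := fun x hx => by
    by_contra h
    have := hR (subset_tsupport φ h)
    simp at this; linarith
  have : IsProbabilityMeasure (volume.restrict (Ycube N)) := ⟨by simp [ycube_vol]⟩
  set ρ := (volume.restrict (Ycube N)).prod (volume : Measure (Fin N → ℝ)) with hρ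
  set B : (Fin N → ℝ) × (Fin N → ℝ) → ℝ :=
    (Set.univ ×ˢ Metric.closedBall 0 (R + 1)).indicator fun _ => 2 * C * M with hB
  have hBi : Integrable B ρ := by
    rw [hB, integrable_indicator_iff (MeasurableSet.univ.prod Metric.isClosed_closedBall.measurableSet)]
    apply integrableOn_const
    · rw [hρ, Measure.prod_prod]; simp
      exact (isCompact_closedBall _ _).measure_lt_top.ne
    · exact enorm_ne_top
  have hbd : ∀ k (s : Fin N → ℝ), s ∈ Ycube N → ∀ x, R + 1 < ‖x‖ → φ (x + δ k • s) = 0 := by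
    intro k s hs x hx
    apply hsupp
    have h1 : ‖δ k • s‖ ≤ 1 := by
      rw [norm_smul, Real.norm_of_nonneg (hδ k).1.le]
      have : ‖s‖ ≤ 1 := by
        rw [pi_norm_le_iff_of_nonneg zero_le_one]
        intro i; rw [Real.norm_of_nonneg (hs.1 i)]; exact hs.2 i
      exact mul_le_one₀ (hδ k).2 (norm_nonneg _) this
    have := norm_sub_norm_le x (-(δ k • s))
    rw [norm_neg, sub_neg_eq_add] at this
    linarith
  have haes : ∀ᵐ p ∂ρ, p.1 ∈ Ycube N := by
    have : ∀ᵐ s ∂(volume.restrict (Ycube N)), s ∈ Ycube N := ae_restrict_mem measurableSet_Icc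
    exact Measure.quasiMeasurePreserving_fst.ae this
  set H : ℕ → (Fin N → ℝ) × (Fin N → ℝ) → ℝ := fun k p => φ (p.2 + δ k • p.1) * g ((δ k)⁻¹ • p.2 + p.1)
  set J : ℕ → (Fin N → ℝ) × (Fin N → ℝ) → ℝ := fun k p => φ p.2 * g ((δ k)⁻¹ • p.2 + p.1)
  have bH : ∀ k, ∀ᵐ p ∂ρ, |H k p| ≤ C * M ∧ (R + 1 < ‖p.2‖ → H k p = 0) := by
    intro k
    filter_upwards [haes] with p hp1
    refine ⟨?_, fun h => by simp [H, hbd k p.1 hp1 p.2 h]⟩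
    rw [abs_mul]; exact mul_le_mul (hC _) (hM _) (abs_nonneg _) hC0
  have bJ : ∀ k p, |J k p| ≤ C * M ∧ (R + 1 < ‖p.2‖ → J k p = 0) := by
    intro k p
    refine ⟨?_, fun h => by simp [J, hsupp p.2 (by linarith)]⟩
    rw [abs_mul]; exact mul_le_mul (hC _) (hM _) (abs_nonneg _) hC0
  have mH : ∀ k, AEStronglyMeasurable (H k) ρ := fun k => by
    apply Continuous.aestronglyMeasurable; fun_prop
  have mJ : ∀ k, AEStronglyMeasurable (J k) ρ := fun k => by
    apply Continuous.aestronglyMeasurable; fun_prop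
  have hCM : 0 ≤ C * M := mul_nonneg hC0 hM0
  have toB : ∀ (z : ℝ) (p : (Fin N → ℝ) × (Fin N → ℝ)), |z| ≤ 2 * (C * M) → (R + 1 < ‖p.2‖ → z = 0) → ‖z‖ ≤ B p := by
    intro z p h1 h2
    by_cases h : ‖p.2‖ ≤ R + 1
    · rw [hB, Set.indicator_of_mem (by simpa using h), Real.norm_eq_abs]; linarith
    · rw [h2 (not_le.1 h), norm_zero, hB]
      exact Set.indicator_nonneg (fun _ _ => by positivity) _
  have iH : ∀ k, Integrable (H k) ρ := fun k => hBi.mono' (mH k) (by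
    filter_upwards [bH k] with p h; exact toB _ _ (by linarith [h.1]) h.2)
  have iJ : ∀ k, Integrable (J k) ρ := fun k => hBi.mono' (mJ k)
    (Eventually.of_forall fun p => toB _ _ (by linarith [(bJ k p).1]) (bJ k p).2)
  have eH : ∀ k, ∫ p, H k p ∂ρ = ∫ x, φ x * g ((δ k)⁻¹ • x) := by
    intro k
    rw [hρ, integral_prod _ (iH k)]
    have : ∀ s : Fin N → ℝ, ∫ x, H k (s, x) = ∫ x, φ x * g ((δ k)⁻¹ • x) := by
      intro s
      rw [← integral_add_right_eq_self (fun x => φ x * g ((δ k)⁻¹ • x)) (δ k • s)]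
      refine integral_congr_ae (Eventually.of_forall fun x => ?_)
      simp only [H, smul_add, smul_smul, inv_mul_cancel₀ (hδ k).1.ne', one_smul]
    simp only [this, integral_const]
    simp
  have eJ : ∀ k, ∫ p, J k p ∂ρ = (∫ x, φ x) * ∫ y in Ycube N, g y := by
    intro k
    rw [hρ, integral_prod_symm _ (iJ k)]
    simp only [J, integral_const_mul, ycube_shift g hp, integral_mul_const]
  have lim : Tendsto (fun k => ∫ p, (H k p - J k p) ∂ρ) atTop (nhds (∫ p, (0 : ℝ) ∂ρ)) := by
    refine tendsto_integral_of_dominated_convergence B (fun k => (mH k).sub (mJ k)) hBi (fun k => ?_) ?_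
    · filter_upwards [bH k] with p h
      apply toB _ _ _ (fun h' => by rw [h.2 h', (bJ k p).2 h', sub_zero])
      have := abs_sub (H k p) (J k p)
      linarith [(bJ k p).1, h.1]
    · refine Eventually.of_forall fun p => ?_
      have h1 : Tendsto (fun k => φ (p.2 + δ k • p.1) - φ p.2) atTop (nhds 0) := by
        have : Tendsto (fun k => φ (p.2 + δ k • p.1)) atTop (nhds (φ (p.2 + (0:ℝ) • p.1))) :=
          (hφ.tendsto _).comp (tendsto_const_nhds.add (hδ0.smul_const _))
        simpa using this.sub_const (φ p.2)
      have h2 := h1.abs.mul_const M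
      simp only [abs_zero, zero_mul] at h2
      refine squeeze_zero_norm (fun k => ?_) h2
      simp only [H, J, ← sub_mul, Real.norm_eq_abs, abs_mul]
      gcongr
      exact hM _
  simp only [integral_zero] at lim
  have e : ∀ k, ∫ p, (H k p - J k p) ∂ρ = (∫ x, φ x * g ((δ k)⁻¹ • x)) - (∫ x, φ x) * ∫ y in Ycube N, g y := by
    intro k; rw [integral_sub (iH k) (iJ k), eH, eJ]
  simp only [e] at lim
  simpa using lim.add_const ((∫ x, φ x) * ∫ y in Ycube N, g y)



open scoped Manifold ContDiff in
lemma partX {N : ℕ} (Q K : Set (Fin N → ℝ)) (hQo : IsOpen Q) (hQb : Bornology.IsBounded Q)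
    (hK : IsCompact K) (hKQ : K ⊆ Q) (δ : ℝ) (hδ : 0 < δ) :
    ∃ (s : Finset (Fin N → ℝ)) (φ : (Fin N → ℝ) → (Fin N → ℝ) → ℝ),
      (∀ i ∈ s, i ∈ Q) ∧
      (∀ i, ContDiff ℝ (⊤ : ℕ∞) (φ i) ∧ HasCompactSupport (φ i) ∧ tsupport (φ i) ⊆ Q ∧
        (∀ x, 0 ≤ φ i x) ∧ ∀ x, φ i x ≠ 0 → x ∈ Q ∧ dist x i < δ) ∧
      (∀ x, ∑ i ∈ s, φ i x ≤ 1) ∧ ∀ x ∈ K, ∑ i ∈ s, φ i x = 1 := by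
  classical
  obtain ⟨t, htK, htf, hcov⟩ := hK.finite_cover_balls hδ
  set U : (Fin N → ℝ) → Set (Fin N → ℝ) := fun i => if i ∈ t then Metric.ball i δ ∩ Q else ∅ with hU
  have hUo : ∀ i, IsOpen (U i) := fun i => by
    simp only [hU]; split_ifs
    · exact Metric.isOpen_ball.inter hQo
    · exact isOpen_empty
  have hUQ : ∀ i, U i ⊆ Q ∩ Metric.ball i δ := fun i x hx => by
    simp only [hU] at hx; split_ifs at hx
    · exact ⟨hx.2, hx.1⟩
    · exact hx.elim
  have hKU : K ⊆ ⋃ i, U i := fun x hx => by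
    have := hcov hx
    simp only [Set.mem_iUnion] at this ⊢
    obtain ⟨i, hi, hxi⟩ := this
    exact ⟨i, by simp only [hU, if_pos hi]; exact ⟨hxi, hKQ hx⟩⟩
  obtain ⟨f, hf⟩ := SmoothPartitionOfUnity.exists_isSubordinate 𝓘(ℝ, Fin N → ℝ) hK.isClosed U hUo hKU
  have hsum : ∀ x, ∑ i ∈ htf.toFinset, f i x = ∑ᶠ i, f i x := fun x => by
    rw [finsum_eq_sum_of_support_subset]
    intro i hi
    have h1 : x ∈ U i := hf i (subset_tsupport _ hi)
    simp only [hU] at h1; split_ifs at h1 with h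
    · simpa using h
    · exact h1.elim
  refine ⟨htf.toFinset, fun i x => f i x, fun i hi => hKQ (htK (by simpa using hi)), fun i => ⟨?_, ?_, ?_, ?_, ?_⟩, ?_, ?_⟩
  · exact (f i).contMDiff.contDiff
  · exact Metric.isCompact_of_isClosed_isBounded (isClosed_tsupport _) (hQb.subset ((hf i).trans ((hUQ i).trans Set.inter_subset_left)))
  · exact (hf i).trans ((hUQ i).trans Set.inter_subset_left)
  · exact fun x => f.nonneg i x
  · exact fun x hx => hUQ i (hf i (subset_tsupport _ hx))
  · intro x; rw [hsum]; exact f.sum_le_one x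
  · intro x hx; rw [hsum]; exact f.sum_eq_one hx

lemma partY {N : ℕ} (δ : ℝ) (hδ : 0 < δ) :
    ∃ (s : Finset (Fin N → ℝ)) (g : (Fin N → ℝ) → (Fin N → ℝ) → ℝ),
      (∀ j, Continuous (g j) ∧ ZPeriodic (g j) ∧ (∀ y, 0 ≤ g j y) ∧
        ∀ y, g j y ≠ 0 → ∃ k : Fin N → ℤ, ‖y - j - fun i => (k i : ℝ)‖ < δ) ∧
      (∀ y, ∑ j ∈ s, g j y = 1) := by
  classical
  obtain ⟨t, -, htf, hcov⟩ := (isCompact_Icc (a := (0 : Fin N → ℝ)) (b := 1)).finite_cover_balls hδ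
  set pd : (Fin N → ℝ) → ℝ := fun z => ‖fun i => ((z i : ℝ) : UnitAddCircle)‖ with hpd
  have pdc : Continuous pd := by
    apply Continuous.norm
    refine continuous_pi fun i => ?_
    exact (AddCircle.continuous_mk' 1).comp (continuous_apply i)
  have pdp : ZPeriodic pd := by
    intro y k
    simp only [hpd]
    congr 1
    funext i
    simp only [Pi.add_apply, AddCircle.coe_add]
    have : (((k i : ℝ)) : UnitAddCircle) = 0 := by
      rw [AddCircle.coe_eq_zero_iff]; exact ⟨k i, by simp⟩
    rw [this, add_zero]
  have pdle : ∀ z, pd z ≤ ‖z‖ := by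
    intro z
    rw [hpd, pi_norm_le_iff_of_nonneg (norm_nonneg _)]
    intro i
    rw [UnitAddCircle.norm_eq]
    refine le_trans (by simpa using round_le (z i) 0) (norm_le_pi_norm z i)
  have pdlt : ∀ z, pd z < δ → ∃ k : Fin N → ℤ, ‖z - fun i => (k i : ℝ)‖ < δ := by
    intro z hz
    refine ⟨fun i => round (z i), ?_⟩
    rw [hpd, pi_norm_lt_iff hδ] at hz
    rw [pi_norm_lt_iff hδ]
    intro i
    have := hz i
    rw [UnitAddCircle.norm_eq] at this
    simpa using this
  set G : (Fin N → ℝ) → (Fin N → ℝ) → ℝ := fun j y => max 0 (δ - pd (y - j)) with hG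
  have Gc : ∀ j, Continuous (G j) := fun j => by
    have : Continuous fun y => pd (y - j) := pdc.comp (continuous_id.sub continuous_const)
    fun_prop
  have Gp : ∀ j, ZPeriodic (G j) := fun j y k => by
    simp only [hG]
    rw [show (y + fun i => (k i : ℝ)) - j = (y - j) + fun i => (k i : ℝ) by abel, pdp]
  have Gn : ∀ j y, 0 ≤ G j y := fun j y => le_max_left _ _
  set S : (Fin N → ℝ) → ℝ := fun y => ∑ j ∈ htf.toFinset, G j y with hS
  have Sp : ZPeriodic S := fun y k => by simp only [hS]; exact Finset.sum_congr rfl fun j _ => Gp j y k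
  have Sc : Continuous S := continuous_finsetSum _ fun j _ => Gc j
  have Spos : ∀ y, 0 < S y := by
    intro y
    obtain ⟨k, hk⟩ := zper_reduce y
    rw [← Sp y k]
    have := hcov hk
    simp only [Set.mem_iUnion] at this
    obtain ⟨j, hj, hd⟩ := this
    refine Finset.sum_pos' (fun j _ => Gn j _) ⟨j, by simpa using hj, ?_⟩
    refine lt_max_of_lt_right ?_
    rw [Metric.mem_ball, dist_eq_norm] at hd
    linarith [pdle ((y + fun i => (k i : ℝ)) - j)]
  refine ⟨htf.toFinset, fun j y => G j y / S y, fun j => ⟨?_, ?_, ?_, ?_⟩, fun y => ?_⟩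
  · exact (Gc j).div Sc fun y => (Spos y).ne'
  · intro y k; simp only [Gp j y k, Sp y k]
  · intro y; exact div_nonneg (Gn _ _) (Spos y).le
  · intro y hy
    apply pdlt
    by_contra h
    apply hy
    have : G j y = 0 := max_eq_left (by linarith [not_lt.1 h])
    change G j y / S y = 0
    rw [this, zero_div]
  · rw [← Finset.sum_div]; exact div_self (Spos y).ne'

lemma modulus {N : ℕ} (Q : Set (Fin N → ℝ)) (hQb : Bornology.IsBounded Q)
    (a : (Fin N → ℝ) → (Fin N → ℝ) → ℝ) (ha : Continuous fun q : (Fin N → ℝ) × (Fin N → ℝ) => a q.1 q.2)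
    (hp : ∀ x, ZPeriodic (a x)) (η : ℝ) (hη : 0 < η) :
    ∃ δ : ℝ, 0 < δ ∧ ∀ x ∈ Q, ∀ x' ∈ Q, ∀ y y' : Fin N → ℝ, dist x x' < δ →
      (∃ k : Fin N → ℤ, ‖y - y' - fun i => (k i : ℝ)‖ < δ) → |a x y - a x' y'| ≤ η := by
  have hcomp : IsCompact (closure Q ×ˢ Metric.closedBall (0 : Fin N → ℝ) 2) :=
    hQb.isCompact_closure.prod (isCompact_closedBall _ _)
  have huc := hcomp.uniformContinuousOn_of_continuous ha.continuousOn
  obtain ⟨δ, hδ, H⟩ := Metric.uniformContinuousOn_iff.1 huc η hη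
  refine ⟨min δ 1, by positivity, fun x hx x' hx' y y' hxx ⟨k, hk⟩ => ?_⟩
  obtain ⟨l, hl⟩ := zper_reduce y
  have e2 : a x' y' = a x' (y' + fun i => ((k i + l i : ℤ) : ℝ)) := (hp x' y' _).symm
  rw [← hp x y l, e2]
  set z := y + fun i => (l i : ℝ) with hz
  set z' := y' + fun i => ((k i + l i : ℤ) : ℝ) with hz'
  have hzz : ‖z - z'‖ < min δ 1 := by
    convert hk using 2
    funext i; simp [hz, hz']; ring
  have hz1 : ‖z‖ ≤ 1 := by
    rw [pi_norm_le_iff_of_nonneg zero_le_one]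
    intro i; rw [Real.norm_of_nonneg (hl.1 i)]; exact hl.2 i
  have hz2 : ‖z'‖ ≤ 2 := by
    have := norm_sub_norm_le z' z
    rw [norm_sub_rev] at this
    linarith [hzz.trans_le (min_le_right _ _)]
  have := H (x, z) ⟨subset_closure hx, by simp; linarith⟩ (x', z') ⟨subset_closure hx', by simpa using hz2⟩
    (by
      rw [Prod.dist_eq, max_lt_iff]
      exact ⟨hxx.trans_le (min_le_left _ _), by rw [dist_eq_norm]; exact hzz.trans_le (min_le_left _ _)⟩)
  rw [Real.dist_eq] at this
  exact this.le



/-- Admissible test functions. -/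
def Adm {N : ℕ} {Ω : Type*} [MeasurableSpace Ω] (a : (Fin N → ℝ) → Ω → (Fin N → ℝ) → ℝ) (M : ℝ) : Prop :=
  (∀ ω, Continuous fun q : (Fin N → ℝ) × (Fin N → ℝ) => a q.1 ω q.2) ∧
  (∀ x y, Measurable fun ω => a x ω y) ∧ (∀ x ω, ZPeriodic (a x ω)) ∧ ∀ x ω y, |a x ω y| ≤ M

lemma cara_meas {N : ℕ} {Ω : Type*} [MeasurableSpace Ω] {a : (Fin N → ℝ) → Ω → (Fin N → ℝ) → ℝ}
    (h1 : ∀ ω, Continuous fun q : (Fin N → ℝ) × (Fin N → ℝ) => a q.1 ω q.2)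
    (h2 : ∀ x y, Measurable fun ω => a x ω y) :
    Measurable fun p : ((Fin N → ℝ) × Ω) × (Fin N → ℝ) => a p.1.1 p.1.2 p.2 := by
  have := measurable_uncurry_of_continuous_of_measurable
    (u := fun (q : (Fin N → ℝ) × (Fin N → ℝ)) (ω : Ω) => a q.1 ω q.2) h1 (fun q => h2 q.1 q.2)
  exact this.comp (by fun_prop : Measurable fun p : ((Fin N → ℝ) × Ω) × (Fin N → ℝ) => ((p.1.1, p.2), p.1.2))

lemma approx {N : ℕ} (hN : 1 ≤ N) {Ω : Type*} [MeasurableSpace Ω]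
    (Q : Set (Fin N → ℝ)) (hQo : IsOpen Q) (hQb : Bornology.IsBounded Q)
    (a : (Fin N → ℝ) → Ω → (Fin N → ℝ) → ℝ) (M : ℝ) (hM : 0 ≤ M) (ha : Adm a M) :
    ∃ (s t : ℕ → Finset (Fin N → ℝ)) (φ g : ℕ → (Fin N → ℝ) → (Fin N → ℝ) → ℝ)
      (e : ℕ → (Fin N → ℝ) → Ω → ℝ),
      (∀ m i, ContDiff ℝ (⊤ : ℕ∞) (φ m i) ∧ HasCompactSupport (φ m i) ∧ tsupport (φ m i) ⊆ Q) ∧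
      (∀ m j, Continuous (g m j) ∧ ZPeriodic (g m j)) ∧
      (∀ m, Measurable fun p : (Fin N → ℝ) × Ω => e m p.1 p.2) ∧
      (∀ m x ω, 0 ≤ e m x ω ∧ e m x ω ≤ 3 * M) ∧
      (∀ x ∈ Q, ∀ ω, Tendsto (fun m => e m x ω) atTop (nhds 0)) ∧
      ∀ m x ω y, |a x ω y - ∑ i ∈ s m, ∑ j ∈ t m, φ m i x * a i ω j * g m j y| ≤ e m x ω := by
  have : Nonempty (Fin N) := ⟨⟨0, hN⟩⟩
  have hQc : Qᶜ.Nonempty := by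
    rw [Set.nonempty_compl]; rintro rfl
    exact NormedSpace.unbounded_univ ℝ (Fin N → ℝ) hQb
  set K : ℕ → Set (Fin N → ℝ) := fun m => {x | 1 / ((m : ℝ) + 1) ≤ Metric.infDist x Qᶜ} with hKdef
  have hKQ : ∀ m, K m ⊆ Q := fun m x hx => by
    by_contra h
    have : Metric.infDist x Qᶜ = 0 := Metric.infDist_zero_of_mem h
    simp only [hKdef, Set.mem_ofPred_eq, this] at hx
    have : 0 < 1 / ((m : ℝ) + 1) := Nat.one_div_pos_of_nat
    linarith
  have hKc : ∀ m, IsCompact (K m) := fun m =>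
    Metric.isCompact_of_isClosed_isBounded
      (isClosed_le continuous_const (Metric.continuous_infDist_pt _)) (hQb.subset (hKQ m))
  have hKe : ∀ x ∈ Q, ∀ᶠ m in atTop, x ∈ K m := fun x hx => by
    have : 0 < Metric.infDist x Qᶜ :=
      (hQo.isClosed_compl.notMem_iff_infDist_pos hQc).1 (by simpa using hx)
    exact (tendsto_one_div_add_atTop_nhds_zero_nat.eventually (gt_mem_nhds this)).mono fun m hm => le_of_lt hm
  choose s φ hsQ hφ hφ1 hφK using fun m : ℕ =>
    partX Q (K m) hQo hQb (hKc m) (hKQ m) (1 / ((m : ℝ) + 1)) Nat.one_div_pos_of_nat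
  choose t g hg hg1 using fun m : ℕ => partY (N := N) (1 / ((m : ℝ) + 1)) Nat.one_div_pos_of_nat
  obtain ⟨hac, ham, hap, hab⟩ := ha
  set p : ℕ → (Fin N → ℝ) → Ω → (Fin N → ℝ) → ℝ :=
    fun m x ω y => ∑ i ∈ s m, ∑ j ∈ t m, φ m i x * a i ω j * g m j y with hp
  set χ : ℕ → (Fin N → ℝ) → ℝ := fun m x => ∑ i ∈ s m, φ m i x with hχ
  set w : ℕ → Ω → (Fin N → ℝ) × (Fin N → ℝ) → ℝ := fun m ω q => χ m q.1 * a q.1 ω q.2 - p m q.1 ω q.2 with hw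
  have φc : ∀ m i, Continuous (φ m i) := fun m i => (hφ m i).1.continuous
  have gc : ∀ m i, Continuous (g m i) := fun m i => (hg m i).1
  have χc : ∀ m, Continuous (χ m) := fun m => continuous_finsetSum _ fun i _ => φc m i
  have wc : ∀ m ω, Continuous (w m ω) := by
    intro m ω
    refine (((χc m).comp continuous_fst).mul (hac ω)).sub ?_
    refine continuous_finsetSum _ fun i _ => continuous_finsetSum _ fun j _ => ?_
    exact (((φc m i).comp continuous_fst).mul continuous_const).mul ((gc m j).comp continuous_snd)
  have wm : ∀ m q, Measurable fun ω => w m ω q := by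
    intro m q
    refine (measurable_const.mul (ham _ _)).sub ?_
    refine Finset.measurable_fun_sum _ fun i _ => Finset.measurable_fun_sum _ fun j _ => ?_
    exact (measurable_const.mul (ham _ _)).mul measurable_const
  have weq : ∀ m ω q, w m ω q = ∑ i ∈ s m, ∑ j ∈ t m, φ m i q.1 * g m j q.2 * (a q.1 ω q.2 - a i ω j) := by
    intro m ω q
    simp only [hw, hχ, hp]
    rw [Finset.sum_mul, ← Finset.sum_sub_distrib]
    refine Finset.sum_congr rfl fun i _ => ?_
    have : φ m i q.1 * a q.1 ω q.2 = ∑ j ∈ t m, φ m i q.1 * g m j q.2 * a q.1 ω q.2 := by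
      rw [← Finset.sum_mul, ← Finset.mul_sum, hg1, mul_one]
    rw [this, ← Finset.sum_sub_distrib]
    refine Finset.sum_congr rfl fun j _ => ?_
    ring
  have wle : ∀ m ω q c, 0 ≤ c → (∀ i ∈ s m, ∀ j ∈ t m, φ m i q.1 ≠ 0 → g m j q.2 ≠ 0 →
      |a q.1 ω q.2 - a i ω j| ≤ c) → |w m ω q| ≤ c := by
    intro m ω q c hc h
    rw [weq]
    calc _ ≤ ∑ i ∈ s m, ∑ j ∈ t m, φ m i q.1 * g m j q.2 * c := by
          refine (Finset.abs_sum_le_sum_abs _ _).trans (Finset.sum_le_sum fun i hi => ?_)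
          refine (Finset.abs_sum_le_sum_abs _ _).trans (Finset.sum_le_sum fun j hj => ?_)
          have h1 := (hφ m i).2.2.2.1 q.1
          have h2 := (hg m j).2.2.1 q.2
          rw [abs_mul, abs_of_nonneg (mul_nonneg h1 h2)]
          by_cases h3 : φ m i q.1 = 0
          · simp [h3]
          by_cases h4 : g m j q.2 = 0
          · simp [h4]
          exact mul_le_mul_of_nonneg_left (h i hi j hj h3 h4) (mul_nonneg h1 h2)
      _ = χ m q.1 * c := by
          simp only [← Finset.sum_mul, ← Finset.mul_sum, hg1, mul_one, hχ]
      _ ≤ 1 * c := by gcongr; exact hφ1 m q.1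
      _ = c := one_mul c
  have w2 : ∀ m ω q, |w m ω q| ≤ 2 * M := fun m ω q => wle m ω q _ (by positivity) fun i _ j _ _ _ => by
    have := abs_sub (a q.1 ω q.2) (a i ω j)
    linarith [hab q.1 ω q.2, hab i ω j]
  set z := TopologicalSpace.denseSeq ((Fin N → ℝ) × (Fin N → ℝ))
  set d : ℕ → Ω → ℝ := fun m ω => ⨆ n, |w m ω (z n)| with hd
  have dbdd : ∀ m ω, BddAbove (Set.range fun n => |w m ω (z n)|) := fun m ω =>
    ⟨2 * M, by rintro _ ⟨n, rfl⟩; exact w2 m ω _⟩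
  have dm : ∀ m, Measurable (d m) := fun m => Measurable.iSup fun n => (wm m (z n)).abs
  have wd : ∀ m ω q, |w m ω q| ≤ d m ω := by
    intro m ω
    have hcl : IsClosed {q | |w m ω q| ≤ d m ω} := isClosed_le (wc m ω).abs continuous_const
    have hden : Dense {q | |w m ω q| ≤ d m ω} :=
      (TopologicalSpace.denseRange_denseSeq _).mono (by
        rintro _ ⟨n, rfl⟩; exact le_ciSup (dbdd m ω) n)
    intro q
    have := hcl.closure_eq ▸ hden.closure_eq
    exact (this ▸ Set.mem_univ q : q ∈ {q | |w m ω q| ≤ d m ω})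
  have d0 : ∀ m ω, 0 ≤ d m ω := fun m ω => (abs_nonneg _).trans (wd m ω 0)
  have d2 : ∀ m ω, d m ω ≤ 2 * M := fun m ω => ciSup_le fun n => w2 m ω _
  have dlim : ∀ ω, Tendsto (fun m => d m ω) atTop (nhds 0) := by
    intro ω
    rw [Metric.tendsto_atTop]
    intro η hη
    obtain ⟨δ, hδ, H⟩ := modulus Q hQb (fun x y => a x ω y) (hac ω) (fun x => hap x ω) (η / 2) (by positivity)
    obtain ⟨n, hn⟩ := eventually_atTop.1 (tendsto_one_div_add_atTop_nhds_zero_nat.eventually (gt_mem_nhds hδ))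
    refine ⟨n, fun m hm => ?_⟩
    rw [Real.dist_eq, sub_zero, abs_of_nonneg (d0 m ω)]
    refine lt_of_le_of_lt (ciSup_le fun l => ?_) (half_lt_self hη)
    refine wle m ω _ _ (by positivity) fun i hi j _ h1 h2 => ?_
    obtain ⟨hxQ, hxi⟩ := (hφ m i).2.2.2.2 _ h1
    obtain ⟨k, hk⟩ := (hg m j).2.2.2 _ h2
    exact H _ hxQ _ (hsQ m i hi) _ _ (hxi.trans (hn m hm)) ⟨k, hk.trans (hn m hm)⟩
  have χ0 : ∀ m x, 0 ≤ χ m x := fun m x => Finset.sum_nonneg fun i _ => (hφ m i).2.2.2.1 x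
  refine ⟨s, t, φ, g, fun m x ω => d m ω + M * (1 - χ m x), fun m i => ⟨(hφ m i).1, (hφ m i).2.1, (hφ m i).2.2.1⟩,
    fun m j => ⟨(hg m j).1, (hg m j).2.1⟩, fun m => ?_, fun m x ω => ⟨?_, ?_⟩, fun x hx ω => ?_, fun m x ω y => ?_⟩
  · exact ((dm m).comp measurable_snd).add
      (measurable_const.mul (measurable_const.sub ((χc m).measurable.comp measurable_fst)))
  · exact add_nonneg (d0 m ω) (mul_nonneg hM (sub_nonneg.2 (hφ1 m x)))
  · nlinarith [d2 m ω, mul_nonneg hM (χ0 m x)]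
  · refine (dlim ω).congr' ?_
    filter_upwards [hKe x hx] with m hm
    have : χ m x = 1 := hφK m x hm
    rw [this]; ring
  · have h1 := wd m ω (x, y)
    have : a x ω y - p m x ω y = w m ω (x, y) + a x ω y * (1 - χ m x) := by simp only [hw]; ring
    change |a x ω y - p m x ω y| ≤ _
    rw [this]
    refine (abs_add_le _ _).trans (add_le_add h1 ?_)
    rw [abs_mul, abs_of_nonneg (sub_nonneg.2 (hφ1 m x))]
    exact mul_le_mul_of_nonneg_right (hab x ω y) (sub_nonneg.2 (hφ1 m x))


lemma skew_mp {N : ℕ} {Ω : Type*} [MeasurableSpace Ω] (μ : Measure Ω) [IsProbabilityMeasure μ]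
    (T : (Fin N → ℝ) → Ω → Ω) (hT : IsDynSys μ T) (Q : Set (Fin N → ℝ)) (c : ℝ) :
    MeasurePreserving (fun p : (Fin N → ℝ) × Ω => (p.1, T (c • p.1) p.2))
      ((volume.restrict Q).prod μ) ((volume.restrict Q).prod μ) := by
  refine MeasurePreserving.skew_product (f := id) (g := fun x ω => T (c • x) ω) (MeasurePreserving.id _) ?_ ?_
  · exact hT.2.2.2.comp (by fun_prop : Measurable fun p : (Fin N → ℝ) × Ω => (c • p.1, p.2))
  · exact Eventually.of_forall fun x => (hT.2.2.1 (c • x)).map_eq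

lemma int_mul_bdd {X : Type*} [MeasurableSpace X] {ν : Measure X} {u b : X → ℝ} (hu : Integrable u ν)
    (hb : Measurable b) (M : ℝ) (hM : ∀ x, |b x| ≤ M) : Integrable (fun x => u x * b x) ν := by
  refine (hu.abs.mul_const M).mono' (hu.1.mul hb.aestronglyMeasurable) (Eventually.of_forall fun x => ?_)
  rw [Real.norm_eq_abs, abs_mul]
  exact mul_le_mul_of_nonneg_left (hM x) (abs_nonneg _)

theorem ext2s {N : ℕ} (hN : 1 ≤ N) {Ω : Type*} [MeasurableSpace Ω] (μ : Measure Ω)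
    [IsProbabilityMeasure μ] (T : (Fin N → ℝ) → Ω → Ω) (hT : IsDynSys μ T)
    (Q : Set (Fin N → ℝ)) (hQo : IsOpen Q) (hQb : Bornology.IsBounded Q)
    (ε : ℕ → ℝ)
    (u : ℕ → (Fin N → ℝ) → Ω → ℝ) (hum : ∀ k, Measurable fun p : (Fin N → ℝ) × Ω => u k p.1 p.2)
    (F : ℕ → (Fin N → ℝ) × Ω → ℝ) (hFi : ∀ k, Integrable (F k) ((volume.restrict Q).prod μ))
    (hF0 : ∀ k p, 0 ≤ F k p) (C : ℝ) (hFC : ∀ k, ∫ p, F k p ∂((volume.restrict Q).prod μ) ≤ C)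
    (hUI : ∀ η : ℝ, 0 < η → ∃ R : ℝ, 0 ≤ R ∧ ∀ k p, |u k p.1 p.2| ≤ R + η * F k p)
    (u₀ : (Fin N → ℝ) → Ω → (Fin N → ℝ) → ℝ)
    (hu₀ : Integrable (fun p : ((Fin N → ℝ) × Ω) × (Fin N → ℝ) => u₀ p.1.1 p.1.2 p.2)
      (((volume.restrict Q).prod μ).prod (volume.restrict (Ycube N))))
    (hconv : WeakStoch2Scale μ T Q ε u u₀)
    (a : (Fin N → ℝ) → Ω → (Fin N → ℝ) → ℝ) (M : ℝ) (hM : 0 ≤ M) (ha : Adm a M) :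
    Tendsto (fun k => ∫ p, u k p.1 p.2 * a p.1 (T ((ε k)⁻¹ • p.1) p.2) (((ε k) ^ 2)⁻¹ • p.1)
        ∂((volume.restrict Q).prod μ)) atTop
      (nhds (∫ p, u₀ p.1.1 p.1.2 p.2 * a p.1.1 p.1.2 p.2
        ∂(((volume.restrict Q).prod μ).prod (volume.restrict (Ycube N))))) := by
  have hQfin : IsFiniteMeasure (volume.restrict Q) := ⟨by simpa using hQb.measure_lt_top⟩
  have hYfin : IsFiniteMeasure (volume.restrict (Ycube N)) := ⟨by simp [ycube_vol]⟩
  set ν := (volume.restrict Q).prod μ with hν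
  set σ := ν.prod (volume.restrict (Ycube N)) with hσ
  have hC : 0 ≤ C := (integral_nonneg (hF0 0)).trans (hFC 0)
  obtain ⟨s, t, φ, g, e, hφ, hg, em, eb, elim, ee⟩ := approx hN Q hQo hQb a M hM ha
  obtain ⟨hac, ham, hap, hab⟩ := ha
  have hui : ∀ k, Integrable (fun p : (Fin N → ℝ) × Ω => u k p.1 p.2) ν := by
    intro k
    obtain ⟨R, _, hR⟩ := hUI 1 one_pos
    exact ((integrable_const R).add ((hFi k).const_mul 1)).mono' (hum k).aestronglyMeasurable
      (Eventually.of_forall fun p => hR k p)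
  -- the substitution
  set τ : ℕ → (Fin N → ℝ) × Ω → ((Fin N → ℝ) × Ω) × (Fin N → ℝ) :=
    fun k p => ((p.1, T ((ε k)⁻¹ • p.1) p.2), ((ε k) ^ 2)⁻¹ • p.1) with hτ
  have τm : ∀ k, Measurable (τ k) := fun k =>
    (skew_mp μ T hT Q (ε k)⁻¹).measurable.prodMk (by fun_prop)
  have am : Measurable fun p : ((Fin N → ℝ) × Ω) × (Fin N → ℝ) => a p.1.1 p.1.2 p.2 := cara_meas hac ham
  set P : ℕ → (Fin N → ℝ) → Ω → (Fin N → ℝ) → ℝ :=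
    fun m x ω y => ∑ i ∈ s m, ∑ j ∈ t m, φ m i x * a i ω j * g m j y with hP
  have φc : ∀ m i, Continuous (φ m i) := fun m i => (hφ m i).1.continuous
  have gc : ∀ m i, Continuous (g m i) := fun m i => (hg m i).1
  have tm : ∀ m i j, Measurable fun p : ((Fin N → ℝ) × Ω) × (Fin N → ℝ) => φ m i p.1.1 * a i p.1.2 j * g m j p.2 := by
    intro m i j
    exact (((φc m i).measurable.comp (measurable_fst.comp measurable_fst)).mul
      ((ham i j).comp (measurable_snd.comp measurable_fst))).mul ((gc m j).measurable.comp measurable_snd)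
  have Pm : ∀ m, Measurable fun p : ((Fin N → ℝ) × Ω) × (Fin N → ℝ) => P m p.1.1 p.1.2 p.2 := by
    intro m
    exact Finset.measurable_fun_sum _ fun i _ => Finset.measurable_fun_sum _ fun j _ => tm m i j
  have Pb : ∀ m x ω y, |P m x ω y| ≤ 4 * M := by
    intro m x ω y
    have h1 := ee m x ω y
    have h2 := (eb m x ω).2
    have h3 := hab x ω y
    have : P m x ω y = a x ω y - (a x ω y - P m x ω y) := by ring
    rw [this]
    refine (abs_sub _ _).trans ?_
    have : |a x ω y - P m x ω y| ≤ e m x ω := h1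
    linarith
  have tb : ∀ m i j, ∃ D : ℝ, ∀ x ω y, |φ m i x * a i ω j * g m j y| ≤ D := by
    intro m i j
    obtain ⟨D1, hD1⟩ := (hφ m i).2.1.exists_bound_of_continuous (φc m i)
    obtain ⟨D2, hD20, hD2⟩ := zper_bdd _ (gc m j) (hg m j).2
    refine ⟨D1 * M * D2, fun x ω y => ?_⟩
    rw [abs_mul, abs_mul]
    have := (norm_nonneg _).trans (hD1 0)
    gcongr
    · exact hD1 x
    · exact hab _ _ _
    · exact hD2 y
  -- convergence for P m
  have step1 : ∀ m, Tendsto (fun k => ∫ p, u k p.1 p.2 * P m (τ k p).1.1 (τ k p).1.2 (τ k p).2 ∂ν) atTop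
      (nhds (∫ p, u₀ p.1.1 p.1.2 p.2 * P m p.1.1 p.1.2 p.2 ∂σ)) := by
    intro m
    have e1 : ∀ k, ∫ p, u k p.1 p.2 * P m (τ k p).1.1 (τ k p).1.2 (τ k p).2 ∂ν =
        ∑ i ∈ s m, ∑ j ∈ t m, ∫ x in Q, (∫ ω, u k x ω * φ m i x * a i (T ((ε k)⁻¹ • x) ω) j *
              g m j (((ε k) ^ 2)⁻¹ • x) ∂μ) := by
      intro k
      have int : ∀ i j, Integrable (fun p : (Fin N → ℝ) × Ω => u k p.1 p.2 *
          (φ m i (τ k p).1.1 * a i (τ k p).1.2 j * g m j (τ k p).2)) ν := fun i j => by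
        obtain ⟨D, hD⟩ := tb m i j
        exact int_mul_bdd (hui k) ((tm m i j).comp (τm k)) D fun p => hD _ _ _
      simp only [hP, Finset.mul_sum]
      rw [integral_finsetSum _ fun i _ => integrable_finsetSum _ fun j _ => int i j]
      refine Finset.sum_congr rfl fun i _ => ?_
      rw [integral_finsetSum _ fun j _ => int i j]
      refine Finset.sum_congr rfl fun j _ => ?_
      rw [hν, integral_prod _ (int i j)]
      simp only [hτ, mul_assoc]
    have e2 : ∫ p, u₀ p.1.1 p.1.2 p.2 * P m p.1.1 p.1.2 p.2 ∂σ =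
        ∑ i ∈ s m, ∑ j ∈ t m, ∫ x in Q, (∫ ω, (∫ y in Ycube N, u₀ x ω y * φ m i x * a i ω j * g m j y) ∂μ) := by
      have int : ∀ i j, Integrable (fun p : ((Fin N → ℝ) × Ω) × (Fin N → ℝ) => u₀ p.1.1 p.1.2 p.2 *
          (φ m i p.1.1 * a i p.1.2 j * g m j p.2)) σ := fun i j => by
        obtain ⟨D, hD⟩ := tb m i j
        exact int_mul_bdd hu₀ (tm m i j) D fun p => hD _ _ _
      simp only [hP, Finset.mul_sum]
      rw [integral_finsetSum _ fun i _ => integrable_finsetSum _ fun j _ => int i j]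
      refine Finset.sum_congr rfl fun i _ => ?_
      rw [integral_finsetSum _ fun j _ => int i j]
      refine Finset.sum_congr rfl fun j _ => ?_
      rw [hσ, integral_prod _ (int i j), hν, integral_prod _ (by exact (int i j).integral_prod_left)]
      simp only [mul_assoc]
    simp only [e1]
    rw [e2]
    refine tendsto_finsetSum _ fun i _ => tendsto_finsetSum _ fun j _ => ?_
    exact hconv (φ m i) (hφ m i).1 (hφ m i).2.1 (hφ m i).2.2 (fun ω => a i ω j) (ham i j)
      ⟨M, fun ω => hab _ _ _⟩ (g m j) (gc m j) (hg m j).2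
  -- errors
  have ei : ∀ m, Integrable (fun p : (Fin N → ℝ) × Ω => e m p.1 p.2) ν := fun m =>
    (integrable_const (3 * M)).mono' (em m).aestronglyMeasurable (Eventually.of_forall fun p => by
      rw [Real.norm_of_nonneg (eb m _ _).1]; exact (eb m _ _).2)
  have hQae : ∀ᵐ p ∂ν, p.1 ∈ Q :=
    Measure.quasiMeasurePreserving_fst.ae (ae_restrict_mem hQo.measurableSet)
  have elim2 : Tendsto (fun m => ∫ p, e m p.1 p.2 ∂ν) atTop (nhds 0) := by
    have := tendsto_integral_of_dominated_convergence (μ := ν) (F := fun m p => e m p.1 p.2) (f := fun _ => 0)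
      (fun _ => 3 * M) (fun m => (em m).aestronglyMeasurable) (integrable_const _)
      (fun m => Eventually.of_forall fun p => by
        rw [Real.norm_of_nonneg (eb m _ _).1]; exact (eb m _ _).2)
      (by filter_upwards [hQae] with p hp; exact elim _ hp _)
    simpa using this
  have eint : ∀ m k, ∫ p, e m (τ k p).1.1 (τ k p).1.2 ∂ν = ∫ p, e m p.1 p.2 ∂ν := by
    intro m k
    have h := skew_mp μ T hT Q (ε k)⁻¹
    have := integral_map (μ := ν) h.measurable.aemeasurable (f := fun p => e m p.1 p.2)
      (em m).aestronglyMeasurable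
    rw [← this, h.map_eq]
  have step2 : ∀ η : ℝ, 0 < η → ∀ᶠ m in atTop, ∀ k,
      |∫ p, u k p.1 p.2 * a (τ k p).1.1 (τ k p).1.2 (τ k p).2 ∂ν -
        ∫ p, u k p.1 p.2 * P m (τ k p).1.1 (τ k p).1.2 (τ k p).2 ∂ν| ≤ η := by
    intro η hη
    set η' := η / (2 * (3 * M * C + 1)) with hη'
    have hMC : 0 ≤ 3 * M * C := by positivity
    have hη'0 : 0 < η' := by positivity
    obtain ⟨R, hR0, hR⟩ := hUI η' hη'0
    have hlim : Tendsto (fun m => R * ∫ p, e m p.1 p.2 ∂ν) atTop (nhds 0) := by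
      simpa using elim2.const_mul R
    filter_upwards [hlim.eventually (gt_mem_nhds (half_pos hη))] with m hm k
    have i1 : Integrable (fun p => u k p.1 p.2 * a (τ k p).1.1 (τ k p).1.2 (τ k p).2) ν :=
      int_mul_bdd (hui k) (am.comp (τm k)) M fun p => hab _ _ _
    have i2 : Integrable (fun p => u k p.1 p.2 * P m (τ k p).1.1 (τ k p).1.2 (τ k p).2) ν :=
      int_mul_bdd (hui k) ((Pm m).comp (τm k)) (4 * M) fun p => Pb m _ _ _
    rw [← integral_sub i1 i2]
    have eti : Integrable (fun p => e m (τ k p).1.1 (τ k p).1.2) ν :=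
      ((skew_mp μ T hT Q (ε k)⁻¹).integrable_comp (em m).aestronglyMeasurable).2 (ei m)
    have hint : Integrable (fun p => R * e m (τ k p).1.1 (τ k p).1.2 + η' * (3 * M) * F k p) ν :=
      (eti.const_mul R).add ((hFi k).const_mul _)
    calc _ ≤ ∫ p, (R * e m (τ k p).1.1 (τ k p).1.2 + η' * (3 * M) * F k p) ∂ν := by
          rw [← Real.norm_eq_abs]
          refine norm_integral_le_of_norm_le hint (Eventually.of_forall fun p => ?_)
          rw [← mul_sub, Real.norm_eq_abs, abs_mul]
          have h1 := ee m (τ k p).1.1 (τ k p).1.2 (τ k p).2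
          have h2 := eb m (τ k p).1.1 (τ k p).1.2
          calc _ ≤ (R + η' * F k p) * e m (τ k p).1.1 (τ k p).1.2 :=
                mul_le_mul (hR k p) h1 (abs_nonneg _) (add_nonneg hR0 (mul_nonneg hη'0.le (hF0 k p)))
            _ ≤ _ := by
                rw [add_mul]
                have := mul_le_mul_of_nonneg_left h2.2 (mul_nonneg hη'0.le (hF0 k p))
                linarith
      _ = R * ∫ p, e m p.1 p.2 ∂ν + η' * (3 * M) * ∫ p, F k p ∂ν := by
          rw [integral_add (eti.const_mul R) ((hFi k).const_mul _), integral_const_mul, integral_const_mul, eint]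
      _ ≤ η / 2 + η' * (3 * M) * C := by
          gcongr
          exact hFC k
      _ ≤ η / 2 + η / 2 := by
          gcongr
          rw [hη', mul_assoc, div_mul_eq_mul_div, div_le_div_iff₀ (by positivity) (by positivity)]
          nlinarith
      _ = η := by ring
  have step3 : Tendsto (fun m => ∫ p, u₀ p.1.1 p.1.2 p.2 * P m p.1.1 p.1.2 p.2 ∂σ) atTop
      (nhds (∫ p, u₀ p.1.1 p.1.2 p.2 * a p.1.1 p.1.2 p.2 ∂σ)) := by
    refine tendsto_integral_of_dominated_convergence (fun p => |u₀ p.1.1 p.1.2 p.2| * (4 * M))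
      (fun m => hu₀.1.mul (Pm m).aestronglyMeasurable) (hu₀.abs.mul_const _) (fun m => Eventually.of_forall fun p => ?_) ?_
    · rw [Real.norm_eq_abs, abs_mul]; exact mul_le_mul_of_nonneg_left (Pb m _ _ _) (abs_nonneg _)
    · have : ∀ᵐ p ∂σ, p.1.1 ∈ Q := Measure.quasiMeasurePreserving_fst.ae hQae
      filter_upwards [this] with p hp
      refine Tendsto.const_mul _ ?_
      rw [tendsto_iff_dist_tendsto_zero]
      refine squeeze_zero (fun _ => dist_nonneg) (fun m => ?_) (elim p.1.1 hp p.1.2)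
      rw [dist_comm, Real.dist_eq]; exact ee m _ _ _
  rw [Metric.tendsto_atTop]
  intro η hη
  have h3 := (Metric.tendsto_atTop'.1 step3 (η / 3) (by positivity))
  have h3' : ∀ᶠ m in atTop, dist (∫ p, u₀ p.1.1 p.1.2 p.2 * P m p.1.1 p.1.2 p.2 ∂σ)
    (∫ p, u₀ p.1.1 p.1.2 p.2 * a p.1.1 p.1.2 p.2 ∂σ) < η / 3 := step3.eventually (Metric.ball_mem_nhds _ (by positivity))
  obtain ⟨m, hm2, hm3⟩ := ((step2 (η / 3) (by positivity)).and h3').exists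
  obtain ⟨n, hn⟩ := Metric.tendsto_atTop.1 (step1 m) (η / 3) (by positivity)
  refine ⟨n, fun k hk => ?_⟩
  have h1 := hm2 k
  have h2 := hn k hk
  rw [← Real.dist_eq] at h1
  refine lt_of_le_of_lt (dist_triangle4 _ _ _ _) (by
    refine add_lt_add (add_lt_add_of_le_of_lt h1 h2) hm3) |>.trans_le (by linarith)

lemma const2s {N : ℕ} {Ω : Type*} [MeasurableSpace Ω] (μ : Measure Ω)
    [IsProbabilityMeasure μ] (T : (Fin N → ℝ) → Ω → Ω) (hT : IsDynSys μ T)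
    (Q : Set (Fin N → ℝ))
    (ε : ℕ → ℝ) (hε : ∀ k, ε k ∈ Set.Ioc (0 : ℝ) 1) (hε0 : Tendsto ε atTop (nhds 0)) :
    WeakStoch2Scale μ T Q ε (fun _ _ _ => 1) (fun _ _ _ => 1) := by
  intro φ hφ hφc hφQ ψ hψ hψb g hg hgp
  have e0 : ∀ x, x ∉ Q → φ x = 0 := fun x hx => by
    by_contra h; exact hx (hφQ (subset_tsupport _ h))
  have e1 : ∀ k, ∫ x in Q, (∫ ω, 1 * φ x * ψ (T ((ε k)⁻¹ • x) ω) * g (((ε k) ^ 2)⁻¹ • x) ∂μ) =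
      (∫ x, φ x * g (((ε k) ^ 2)⁻¹ • x)) * ∫ ω, ψ ω ∂μ := by
    intro k
    have : ∀ x, ∫ ω, 1 * φ x * ψ (T ((ε k)⁻¹ • x) ω) * g (((ε k) ^ 2)⁻¹ • x) ∂μ =
        φ x * g (((ε k) ^ 2)⁻¹ • x) * ∫ ω, ψ ω ∂μ := by
      intro x
      rw [integral_mul_const, integral_const_mul]
      have h := hT.2.2.1 ((ε k)⁻¹ • x)
      have := integral_map (μ := μ) h.measurable.aemeasurable (f := ψ) hψ.aestronglyMeasurable
      rw [← this, h.map_eq]; ring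
    simp only [this]
    rw [integral_mul_const, setIntegral_eq_integral_of_forall_compl_eq_zero]
    intro x hx; rw [e0 x hx, zero_mul]
  have e2 : ∫ x in Q, (∫ ω, (∫ y in Ycube N, 1 * φ x * ψ ω * g y) ∂μ) =
      ((∫ x, φ x) * ∫ y in Ycube N, g y) * ∫ ω, ψ ω ∂μ := by
    simp only [integral_const_mul, integral_mul_const, one_mul]
    rw [setIntegral_eq_integral_of_forall_compl_eq_zero e0]; ring
  simp only [e1]
  rw [e2]
  refine Tendsto.mul_const _ ?_
  refine averaging φ hφ.continuous hφc g hg hgp (fun k => ε k ^ 2) (fun k => ⟨pow_pos (hε k).1 2, ?_⟩) ?_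
  · exact pow_le_one₀ (hε k).1.le (hε k).2
  · simpa using hε0.pow 2


/-- good integrands -/
def Good {N : ℕ} {Ω : Type*} [MeasurableSpace Ω] (Φ : ℝ → ℝ) (c : ℝ)
    (f : (Fin N → ℝ) → Ω → (Fin N → ℝ) → (Fin N → ℝ) → ℝ) : Prop :=
  (∀ ω, Continuous fun q : (Fin N → ℝ) × (Fin N → ℝ) × (Fin N → ℝ) => f q.1 ω q.2.1 q.2.2) ∧
  (∀ x y lam, Measurable fun ω => f x ω y lam) ∧
  (∀ (x : Fin N → ℝ) (ω : Ω) (y lam : Fin N → ℝ) (k : Fin N → ℤ),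
    f x ω (y + fun i => (k i : ℝ)) lam = f x ω y lam) ∧
  (∀ x ω y, ConvexOn ℝ Set.univ (f x ω y)) ∧
  ∀ x ω y lam, 0 ≤ f x ω y lam ∧ f x ω y lam ≤ c * (1 + Φ (enorm2 lam))

/-- regularization with a kernel -/
def Kv {N : ℕ} {Ω : Type*} (κ : (Fin N → ℝ) → ℝ)
    (f : (Fin N → ℝ) → Ω → (Fin N → ℝ) → (Fin N → ℝ) → ℝ)
    (x : Fin N → ℝ) (ω : Ω) (y lam : Fin N → ℝ) : ℝ := ∫ η, κ η * f x ω y (lam - η)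

/-- partial derivative -/
def Dj {N : ℕ} (θ : (Fin N → ℝ) → ℝ) (j : Fin N) (η : Fin N → ℝ) : ℝ :=
  fderiv ℝ θ η (fun k => if j = k then 1 else 0)

lemma Dj_cont {N : ℕ} {θ : (Fin N → ℝ) → ℝ} (h : ContDiff ℝ (⊤ : ℕ∞) θ) (j : Fin N) :
    Continuous (Dj θ j) :=
  (h.continuous_fderiv (by simp)).clm_apply continuous_const

lemma Dj_supp {N : ℕ} {θ : (Fin N → ℝ) → ℝ} (h : HasCompactSupport θ) (j : Fin N) :
    HasCompactSupport (Dj θ j) := by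
  have := h.fderiv (𝕜 := ℝ)
  exact this.comp_left (g := fun L : (Fin N → ℝ) →L[ℝ] ℝ => L (fun k => if j = k then 1 else 0)) rfl

lemma good_slice {N : ℕ} {Ω : Type*} [MeasurableSpace Ω] {Φ : ℝ → ℝ} {c : ℝ}
    {f : (Fin N → ℝ) → Ω → (Fin N → ℝ) → (Fin N → ℝ) → ℝ} (h : Good Φ c f) (x : Fin N → ℝ) (ω : Ω)
    (y : Fin N → ℝ) : Continuous (f x ω y) :=
  (h.1 ω).comp (by fun_prop : Continuous fun l : Fin N → ℝ => (x, y, l))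

lemma kint {N : ℕ} {κ g : (Fin N → ℝ) → ℝ} (hκ : Continuous κ) (hs : HasCompactSupport κ)
    (hg : Continuous g) (l : Fin N → ℝ) : Integrable fun η => κ η * g (l - η) :=
  (by fun_prop : Continuous fun η => κ η * g (l - η)).integrable_of_hasCompactSupport hs.mul_right

lemma good_meas4 {N : ℕ} {Ω : Type*} [MeasurableSpace Ω]
    {f : (Fin N → ℝ) → Ω → (Fin N → ℝ) → (Fin N → ℝ) → ℝ}
    (h1 : ∀ ω, Continuous fun q : (Fin N → ℝ) × (Fin N → ℝ) × (Fin N → ℝ) => f q.1 ω q.2.1 q.2.2)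
    (h2 : ∀ x y lam, Measurable fun ω => f x ω y lam) :
    Measurable fun p : (((Fin N → ℝ) × Ω) × (Fin N → ℝ)) × (Fin N → ℝ) => f p.1.1.1 p.1.1.2 p.1.2 p.2 := by
  have := measurable_uncurry_of_continuous_of_measurable
    (u := fun (q : (Fin N → ℝ) × (Fin N → ℝ) × (Fin N → ℝ)) (ω : Ω) => f q.1 ω q.2.1 q.2.2) h1
    (fun q => h2 q.1 q.2.1 q.2.2)
  exact this.comp (by fun_prop : Measurable fun p : (((Fin N → ℝ) × Ω) × (Fin N → ℝ)) × (Fin N → ℝ) =>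
    ((p.1.1.1, p.1.2, p.2), p.1.1.2))

lemma kv_cont {N : ℕ} {Ω : Type*} [MeasurableSpace Ω] {Φ : ℝ → ℝ} {c : ℝ}
    {f : (Fin N → ℝ) → Ω → (Fin N → ℝ) → (Fin N → ℝ) → ℝ} (h : Good Φ c f) {κ : (Fin N → ℝ) → ℝ}
    (hκ : Continuous κ) (hs : HasCompactSupport κ) (ω : Ω) :
    Continuous fun q : (Fin N → ℝ) × (Fin N → ℝ) × (Fin N → ℝ) => Kv κ f q.1 ω q.2.1 q.2.2 := by
  have := continuous_parametric_integral_of_continuous (μ := (volume : Measure (Fin N → ℝ)))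
    (f := fun (q : (Fin N → ℝ) × (Fin N → ℝ) × (Fin N → ℝ)) η => κ η * f q.1 ω q.2.1 (q.2.2 - η))
    (by
      refine (hκ.comp continuous_snd).mul ?_
      exact (h.1 ω).comp (by fun_prop : Continuous fun p : ((Fin N → ℝ) × (Fin N → ℝ) × (Fin N → ℝ)) × (Fin N → ℝ) =>
        (p.1.1, p.1.2.1, p.1.2.2 - p.2))) hs.isCompact
  convert this using 2 with q
  rw [setIntegral_eq_integral_of_forall_compl_eq_zero]; rfl
  intro η hη
  rw [image_eq_zero_of_notMem_tsupport hη, zero_mul]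

lemma kv_meas {N : ℕ} {Ω : Type*} [MeasurableSpace Ω] {Φ : ℝ → ℝ} {c : ℝ}
    {f : (Fin N → ℝ) → Ω → (Fin N → ℝ) → (Fin N → ℝ) → ℝ} (h : Good Φ c f) {κ : (Fin N → ℝ) → ℝ}
    (hκ : Continuous κ) (x y lam : Fin N → ℝ) : Measurable fun ω => Kv κ f x ω y lam := by
  refine (StronglyMeasurable.integral_prod_right (f := fun ω η => κ η * f x ω y (lam - η))
    (Measurable.stronglyMeasurable ?_)).measurable
  refine (hκ.measurable.comp measurable_snd).mul ?_
  exact (good_meas4 h.1 h.2.1).comp (by fun_prop : Measurable fun p : Ω × (Fin N → ℝ) =>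
    (((x, p.1), y), lam - p.2))

lemma kv_per {N : ℕ} {Ω : Type*} [MeasurableSpace Ω] {Φ : ℝ → ℝ} {c : ℝ}
    {f : (Fin N → ℝ) → Ω → (Fin N → ℝ) → (Fin N → ℝ) → ℝ} (h : Good Φ c f) (κ : (Fin N → ℝ) → ℝ)
    (x : Fin N → ℝ) (ω : Ω) (y lam : Fin N → ℝ) (k : Fin N → ℤ) :
    Kv κ f x ω (y + fun i => (k i : ℝ)) lam = Kv κ f x ω y lam := by
  simp only [Kv, h.2.2.1]

lemma kv_bound {N : ℕ} {Ω : Type*} [MeasurableSpace Ω] {Φ : ℝ → ℝ} (hΦ : IsYoung Φ) {c : ℝ} (hc : 0 < c)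
    {f : (Fin N → ℝ) → Ω → (Fin N → ℝ) → (Fin N → ℝ) → ℝ} (h : Good Φ c f) {κ : (Fin N → ℝ) → ℝ}
    (hκ : Continuous κ) (hs : HasCompactSupport κ) (M : ℝ) :
    ∃ K : ℝ, 0 ≤ K ∧ ∀ x ω y lam, ‖lam‖ ≤ M → |Kv κ f x ω y lam| ≤ K := by
  have hc1 : Continuous fun p : (Fin N → ℝ) × (Fin N → ℝ) => Φ (enorm2 (p.1 - p.2)) :=
    (young_enorm_cont hΦ).comp (by fun_prop)
  obtain ⟨D, hD⟩ := ((isCompact_closedBall (0 : Fin N → ℝ) M).prod hs.isCompact).exists_bound_of_continuousOn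
    hc1.continuousOn
  have hκi : Integrable fun η => |κ η| * (c * (1 + |D|)) :=
    ((hκ.integrable_of_hasCompactSupport hs).abs).mul_const _
  refine ⟨∫ η, |κ η| * (c * (1 + |D|)), integral_nonneg fun η => by positivity, fun x ω y lam hl => ?_⟩
  rw [← Real.norm_eq_abs]
  refine norm_integral_le_of_norm_le hκi (Eventually.of_forall fun η => ?_)
  rw [Real.norm_eq_abs, abs_mul]
  by_cases hη : η ∈ tsupport κ
  · refine mul_le_mul_of_nonneg_left ?_ (abs_nonneg _)
    rw [abs_of_nonneg (h.2.2.2.2 _ _ _ _).1]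
    refine (h.2.2.2.2 _ _ _ _).2.trans ?_
    have := hD (lam, η) ⟨by simpa using hl, hη⟩
    have := (le_abs_self _).trans (this.trans (le_abs_self D))
    gcongr
  · rw [image_eq_zero_of_notMem_tsupport hη]; simp

lemma kv_grad_aux {N : ℕ} {θ g : (Fin N → ℝ) → ℝ} (hθ : ContDiff ℝ (⊤ : ℕ∞) θ) (hs : HasCompactSupport θ)
    (h0 : ∀ η, 0 ≤ θ η) (hg : Continuous g) (hgc : ConvexOn ℝ Set.univ g) (lam ξ : Fin N → ℝ) :
    (∫ η, θ η * g (ξ - η)) + ∑ j, (∫ η, Dj θ j η * g (ξ - η)) * (lam j - ξ j) ≤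
      ∫ η, θ η * g (lam - η) := by
  set G : (Fin N → ℝ) → ℝ := fun l => ∫ η, θ η * g (l - η) with hG
  have hGconv : ∀ l l' : Fin N → ℝ, ∀ a b : ℝ, 0 ≤ a → 0 ≤ b → a + b = 1 →
      G (a • l + b • l') ≤ a * G l + b * G l' := by
    intro l l' a b ha hb hab
    have i1 := (kint hθ.continuous hs hg l).const_mul a
    have i2 := (kint hθ.continuous hs hg l').const_mul b
    simp only [hG]
    rw [← integral_const_mul, ← integral_const_mul, ← integral_add i1 i2]
    refine integral_mono (kint hθ.continuous hs hg _) (i1.add i2) fun η => ?_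
    have := hgc.2 (Set.mem_univ (l - η)) (Set.mem_univ (l' - η)) ha hb hab
    have e : a • (l - η) + b • (l' - η) = a • l + b • l' - η := by
      have : η = (a + b) • η := by rw [hab, one_smul]
      nth_rewrite 3 [this]
      rw [smul_sub, smul_sub, add_smul]; abel
    rw [e] at this
    have := mul_le_mul_of_nonneg_left this (h0 η)
    simp only [smul_eq_mul] at this
    show _ ≤ a * (θ η * g (l - η)) + b * (θ η * g (l' - η))
    linarith
  have hfd := hs.hasFDerivAt_convolution_left (ContinuousLinearMap.lsmul ℝ ℝ) (hθ.of_le (by simp))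
    (hg.locallyIntegrable (μ := volume)) ξ
  set D := (convolution (fderiv ℝ θ) g (ContinuousLinearMap.precompL (Fin N → ℝ) (ContinuousLinearMap.lsmul ℝ ℝ)) volume) ξ with hD
  have hfd' : HasFDerivAt G D ξ := hfd
  have hDj : ∀ j, D (fun k => if j = k then 1 else 0) = ∫ η, Dj θ j η * g (ξ - η) := by
    intro j
    have hint := (hs.fderiv (𝕜 := ℝ)).convolutionExists_left
      (ContinuousLinearMap.precompL (Fin N → ℝ) (ContinuousLinearMap.lsmul ℝ ℝ))
      (hθ.continuous_fderiv (by simp)) (hg.locallyIntegrable (μ := volume)) ξ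
    rw [hD, convolution, ContinuousLinearMap.integral_apply hint]
    rfl
  have hDw : D (lam - ξ) = ∑ j, (∫ η, Dj θ j η * g (ξ - η)) * (lam j - ξ j) := by
    have := LinearMap.pi_apply_eq_sum_univ D.toLinearMap (lam - ξ)
    simp only [ContinuousLinearMap.coe_coe] at this
    rw [this]
    refine Finset.sum_congr rfl fun j _ => ?_
    rw [hDj, smul_eq_mul, mul_comm]; rfl
  rw [← hDw]
  have hl : HasDerivAt (fun t : ℝ => ξ + t • (lam - ξ)) (lam - ξ) 0 := by
    simpa using ((hasDerivAt_id (0 : ℝ)).smul_const (lam - ξ)).const_add ξ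
  have hd : HasDerivAt (fun t : ℝ => G (ξ + t • (lam - ξ))) (D (lam - ξ)) 0 := by
    have : HasFDerivAt G D (ξ + (0 : ℝ) • (lam - ξ)) := by simpa using hfd'
    exact this.comp_hasDerivAt 0 hl
  have hcv : ConvexOn ℝ Set.univ (fun t : ℝ => G (ξ + t • (lam - ξ))) := by
    refine ⟨convex_univ, fun s _ t _ a b ha hb hab => ?_⟩
    have := hGconv (ξ + s • (lam - ξ)) (ξ + t • (lam - ξ)) a b ha hb hab
    have e : a • (ξ + s • (lam - ξ)) + b • (ξ + t • (lam - ξ)) = ξ + (a • s + b • t) • (lam - ξ) := by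
      ext i
      simp only [Pi.add_apply, Pi.smul_apply, Pi.sub_apply, smul_eq_mul]
      linear_combination (ξ i) * hab
    rw [e] at this
    simpa using this
  have := hcv.le_slope_of_hasDerivAt (Set.mem_univ 0) (Set.mem_univ 1) one_pos hd
  simp only [slope, sub_zero, inv_one, one_smul, zero_smul, add_zero, vsub_eq_sub, add_sub_cancel] at this
  change G ξ + D (lam - ξ) ≤ G lam
  linarith

lemma kv_grad {N : ℕ} {Ω : Type*} [MeasurableSpace Ω] {Φ : ℝ → ℝ} {c : ℝ}
    {f : (Fin N → ℝ) → Ω → (Fin N → ℝ) → (Fin N → ℝ) → ℝ} (h : Good Φ c f)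
    {θ : (Fin N → ℝ) → ℝ} (hθ : ContDiff ℝ (⊤ : ℕ∞) θ) (hs : HasCompactSupport θ)
    (h0 : ∀ η, 0 ≤ θ η) (x : Fin N → ℝ) (ω : Ω) (y lam ξ : Fin N → ℝ) :
    Kv θ f x ω y ξ + ∑ j, Kv (Dj θ j) f x ω y ξ * (lam j - ξ j) ≤ Kv θ f x ω y lam :=
  kv_grad_aux hθ hs h0 (good_slice h x ω y) (h.2.2.2.1 x ω y) lam ξ

lemma kv_upper {N : ℕ} {Ω : Type*} [MeasurableSpace Ω] {Φ : ℝ → ℝ} (hΦ : IsYoung Φ) {c : ℝ} (hc : 0 < c)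
    {f : (Fin N → ℝ) → Ω → (Fin N → ℝ) → (Fin N → ℝ) → ℝ} (h : Good Φ c f)
    {θ : (Fin N → ℝ) → ℝ} (hθ : ContDiff ℝ (⊤ : ℕ∞) θ) (hs : HasCompactSupport θ)
    (h0 : ∀ η, 0 ≤ θ η) {n : ℕ} (hn : 1 ≤ n)
    (hsup : tsupport θ ⊆ {η : Fin N → ℝ | enorm2 η ≤ 1 / (n : ℝ)}) (h1 : (∫ η, θ η) = 1)
    (A : ℝ) (hA : ∀ t, 0 ≤ t → Φ (t + 1) ≤ A * (1 + Φ t))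
    (x : Fin N → ℝ) (ω : Ω) (y lam : Fin N → ℝ) :
    Kv θ f x ω y lam ≤ f x ω y lam + c * (1 + A * (1 + Φ (enorm2 lam))) / n := by
  set K := f x ω y lam + c * (1 + A * (1 + Φ (enorm2 lam))) / n with hK
  have hn0 : (0 : ℝ) < n := by exact_mod_cast hn
  have hn1 : (1 : ℝ) ≤ n := by exact_mod_cast hn
  have : Kv θ f x ω y lam ≤ ∫ η, θ η * K := by
    refine integral_mono (kint hθ.continuous hs (good_slice h x ω y) lam)
      ((hθ.continuous.integrable_of_hasCompactSupport hs).mul_const K) fun η => ?_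
    by_cases hη : η ∈ tsupport θ
    · refine mul_le_mul_of_nonneg_left ?_ (h0 η)
      have hcv := (h.2.2.2.1 x ω y).2 (Set.mem_univ lam) (Set.mem_univ (lam - (n : ℝ) • η))
        (show (0 : ℝ) ≤ 1 - 1 / (n : ℝ) by rw [sub_nonneg, div_le_one hn0]; exact hn1)
        (show (0 : ℝ) ≤ 1 / (n : ℝ) by positivity) (by ring)
      have e : (1 - 1 / (n : ℝ)) • lam + (1 / (n : ℝ)) • (lam - (n : ℝ) • η) = lam - η := by
        rw [smul_sub, smul_smul, one_div_mul_cancel hn0.ne', one_smul, sub_smul, one_smul]; abel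
      rw [e] at hcv
      simp only [smul_eq_mul] at hcv
      have hfl := (h.2.2.2.2 x ω y lam).1
      have b1 : enorm2 (lam - (n : ℝ) • η) ≤ enorm2 lam + 1 := by
        refine (enorm2_sub_le _ _).trans ?_
        rw [enorm2_smul, abs_of_pos hn0]
        have := mul_le_mul_of_nonneg_left (hsup hη) hn0.le
        rw [mul_one_div_cancel hn0.ne'] at this
        linarith
      have b2 := (young_mono hΦ (enorm2_nonneg _) b1).trans (hA _ (enorm2_nonneg lam))
      have b3 : f x ω y (lam - (n : ℝ) • η) ≤ c * (1 + A * (1 + Φ (enorm2 lam))) :=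
        (h.2.2.2.2 _ _ _ _).2.trans (by gcongr)
      have b4 : 1 / (n : ℝ) * f x ω y (lam - (n : ℝ) • η) ≤ 1 / (n : ℝ) * (c * (1 + A * (1 + Φ (enorm2 lam)))) :=
        mul_le_mul_of_nonneg_left b3 (by positivity)
      have b5 : 0 ≤ 1 / (n : ℝ) * f x ω y lam := by positivity
      have b6 : 1 / (n : ℝ) * (c * (1 + A * (1 + Φ (enorm2 lam)))) = c * (1 + A * (1 + Φ (enorm2 lam))) / n := by ring
      rw [hK]; nlinarith
    · simp [image_eq_zero_of_notMem_tsupport hη]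
  rwa [integral_mul_const, h1, one_mul] at this

lemma kv_nonneg {N : ℕ} {Ω : Type*} [MeasurableSpace Ω] {Φ : ℝ → ℝ} {c : ℝ}
    {f : (Fin N → ℝ) → Ω → (Fin N → ℝ) → (Fin N → ℝ) → ℝ} (h : Good Φ c f)
    {θ : (Fin N → ℝ) → ℝ} (h0 : ∀ η, 0 ≤ θ η) (x : Fin N → ℝ) (ω : Ω) (y lam : Fin N → ℝ) :
    0 ≤ Kv θ f x ω y lam := integral_nonneg fun η => mul_nonneg (h0 η) (h.2.2.2.2 _ _ _ _).1


lemma mollify {N : ℕ} {Ω : Type*} [MeasurableSpace Ω] (μ : Measure Ω)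
    [IsProbabilityMeasure μ] (Q : Set (Fin N → ℝ))
    (w : (Fin N → ℝ) → Ω → (Fin N → ℝ) → ℝ)
    (hw : Measurable fun p : ((Fin N → ℝ) × Ω) × (Fin N → ℝ) => w p.1.1 p.1.2 p.2)
    (hper : ∀ x ω, ZPeriodic (w x ω)) (M : ℝ) (hb : ∀ x ω y, |w x ω y| ≤ M) :
    ∃ a : ℕ → (Fin N → ℝ) → Ω → (Fin N → ℝ) → ℝ, (∀ m, Adm (a m) M) ∧
      ∀ᵐ p ∂(((volume.restrict Q).prod μ).prod (volume.restrict (Ycube N))),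
        Tendsto (fun m => a m p.1.1 p.1.2 p.2) atTop (nhds (w p.1.1 p.1.2 p.2)) := by
  have hH : (volume : Measure ((Fin N → ℝ) × (Fin N → ℝ))).IsAddHaarMeasure := by
    exact Measure.prod.instIsAddHaarMeasure _ _
  have hNI : (volume : Measure ((Fin N → ℝ) × (Fin N → ℝ))).IsNegInvariant := by
    have h1 := Measure.measurePreserving_neg (volume : Measure (Fin N → ℝ))
    exact ⟨(h1.prod h1).map_eq⟩
  set φ : ℕ → ContDiffBump (0 : (Fin N → ℝ) × (Fin N → ℝ)) := fun m =>
    ⟨1 / ((m : ℝ) + 1), 2 * (1 / ((m : ℝ) + 1)), by positivity, by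
      have : 0 < 1 / ((m : ℝ) + 1) := by positivity
      linarith⟩ with hφ
  set κ : ℕ → (Fin N → ℝ) × (Fin N → ℝ) → ℝ := fun m => (φ m).normed volume with hκ
  have κc : ∀ m, Continuous (κ m) := fun m => (φ m).continuous_normed
  have κs : ∀ m, HasCompactSupport (κ m) := fun m => (φ m).hasCompactSupport_normed
  have κ0 : ∀ m z, 0 ≤ κ m z := fun m z => (φ m).nonneg_normed z
  have κ1 : ∀ m, ∫ z, κ m z = 1 := fun m => (φ m).integral_normed
  have κi : ∀ m, Integrable (κ m) := fun m => (κc m).integrable_of_hasCompactSupport (κs m)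
  have wl : ∀ ω, LocallyIntegrable (fun z : (Fin N → ℝ) × (Fin N → ℝ) => w z.1 ω z.2) := by
    intro ω
    refine (locallyIntegrable_const M).mono ?_ (Eventually.of_forall fun z => ?_)
    · exact (hw.comp (by fun_prop : Measurable fun z : (Fin N → ℝ) × (Fin N → ℝ) => ((z.1, ω), z.2))).aestronglyMeasurable
    · exact (hb _ _ _).trans (le_abs_self M)
  set a : ℕ → (Fin N → ℝ) → Ω → (Fin N → ℝ) → ℝ :=
    fun m x ω y => ∫ z, κ m z * w (x - z.1) ω (y - z.2) with ha
  have hconvol : ∀ m ω (q : (Fin N → ℝ) × (Fin N → ℝ)), a m q.1 ω q.2 =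
      convolution (κ m) (fun z : (Fin N → ℝ) × (Fin N → ℝ) => w z.1 ω z.2) (ContinuousLinearMap.lsmul ℝ ℝ) volume q :=
    fun m ω q => rfl
  have ac : ∀ m ω, Continuous fun q : (Fin N → ℝ) × (Fin N → ℝ) => a m q.1 ω q.2 := by
    intro m ω
    simp only [hconvol]
    exact (κs m).continuous_convolution_left _ (κc m) (wl ω)
  have am : ∀ m x y, Measurable fun ω => a m x ω y := by
    intro m x y
    refine (StronglyMeasurable.integral_prod_right
      (f := fun ω (z : (Fin N → ℝ) × (Fin N → ℝ)) => κ m z * w (x - z.1) ω (y - z.2))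
      (Measurable.stronglyMeasurable ?_)).measurable
    refine ((κc m).measurable.comp measurable_snd).mul ?_
    exact hw.comp (by fun_prop : Measurable fun p : Ω × ((Fin N → ℝ) × (Fin N → ℝ)) =>
      ((x - p.2.1, p.1), y - p.2.2))
  refine ⟨a, fun m => ⟨ac m, am m, ?_, ?_⟩, ?_⟩
  · intro x ω y k
    simp only [ha]
    congr 1; ext z
    have := hper (x - z.1) ω (y - z.2) k
    rw [← this]; congr 2; abel
  · intro x ω y
    rw [← Real.norm_eq_abs]
    calc _ ≤ ∫ z, κ m z * M := by
          refine norm_integral_le_of_norm_le ((κi m).mul_const M) (Eventually.of_forall fun z => ?_)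
          rw [Real.norm_eq_abs, abs_mul, abs_of_nonneg (κ0 m z)]
          exact mul_le_mul_of_nonneg_left (hb _ _ _) (κ0 m z)
      _ = M := by rw [integral_mul_const, κ1, one_mul]
  · have hS : MeasurableSet {p : ((Fin N → ℝ) × Ω) × (Fin N → ℝ) |
        Tendsto (fun m => a m p.1.1 p.1.2 p.2) atTop (nhds (w p.1.1 p.1.2 p.2))} :=
      measurableSet_tendsto_fun (f := fun m (p : ((Fin N → ℝ) × Ω) × (Fin N → ℝ)) => a m p.1.1 p.1.2 p.2)
        (fun m => cara_meas (ac m) (am m)) hw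
    have hac : ((volume.restrict Q).prod μ).prod (volume.restrict (Ycube N)) ≪
        ((volume : Measure (Fin N → ℝ)).prod μ).prod (volume : Measure (Fin N → ℝ)) :=
      ((Measure.absolutelyContinuous_of_le Measure.restrict_le_self).prod Measure.AbsolutelyContinuous.rfl).prod
        (Measure.absolutelyContinuous_of_le Measure.restrict_le_self)
    suffices hh : ∀ᵐ p ∂(((volume : Measure (Fin N → ℝ)).prod μ).prod (volume : Measure (Fin N → ℝ))),
        Tendsto (fun m => a m p.1.1 p.1.2 p.2) atTop (nhds (w p.1.1 p.1.2 p.2)) from hac.ae_le hh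
    have mp1 := (measurePreserving_prodAssoc μ (volume : Measure (Fin N → ℝ)) (volume : Measure (Fin N → ℝ))).symm
    have mp2 := (Measure.measurePreserving_swap (μ := μ) (ν := (volume : Measure (Fin N → ℝ)))).prod
      (MeasurePreserving.id (volume : Measure (Fin N → ℝ)))
    have mp := mp2.comp mp1
    rw [← mp.map_eq, ae_map_iff mp.measurable.aemeasurable hS]
    refine (Measure.ae_prod_iff_ae_ae (mp.measurable hS)).2 ?_
    refine Eventually.of_forall fun ω => ?_
    have := ContDiffBump.ae_convolution_tendsto_right_of_locallyIntegrable (μ := volume) (φ := φ) (l := atTop) (K := 2)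
      (by
        have := (tendsto_one_div_add_atTop_nhds_zero_nat (𝕜 := ℝ)).const_mul 2
        simpa [hφ] using this) (Eventually.of_forall fun m => le_rfl) (wl ω)
    exact this


lemma adm_mul {N : ℕ} {Ω : Type*} [MeasurableSpace Ω] {a b : (Fin N → ℝ) → Ω → (Fin N → ℝ) → ℝ} {A B : ℝ}
    (hA : 0 ≤ A) (ha : Adm a A) (hb : Adm b B) : Adm (fun x ω y => a x ω y * b x ω y) (A * B) :=
  ⟨fun ω => (ha.1 ω).mul (hb.1 ω), fun x y => (ha.2.1 x y).mul (hb.2.1 x y),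
    fun x ω y k => by beta_reduce; rw [ha.2.2.1 x ω y k, hb.2.2.1 x ω y k], fun x ω y => by
      rw [abs_mul]; exact mul_le_mul (ha.2.2.2 x ω y) (hb.2.2.2 x ω y) (abs_nonneg _) hA⟩

lemma adm_sub {N : ℕ} {Ω : Type*} [MeasurableSpace Ω] {a b : (Fin N → ℝ) → Ω → (Fin N → ℝ) → ℝ} {A B : ℝ}
    (ha : Adm a A) (hb : Adm b B) : Adm (fun x ω y => a x ω y - b x ω y) (A + B) :=
  ⟨fun ω => (ha.1 ω).sub (hb.1 ω), fun x y => (ha.2.1 x y).sub (hb.2.1 x y),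
    fun x ω y k => by beta_reduce; rw [ha.2.2.1 x ω y k, hb.2.2.1 x ω y k], fun x ω y =>
      (abs_sub _ _).trans (add_le_add (ha.2.2.2 x ω y) (hb.2.2.2 x ω y))⟩

lemma adm_sum {N : ℕ} {Ω ι : Type*} [MeasurableSpace Ω] [Fintype ι]
    {a : ι → (Fin N → ℝ) → Ω → (Fin N → ℝ) → ℝ} {A : ι → ℝ}
    (ha : ∀ i, Adm (a i) (A i)) : Adm (fun x ω y => ∑ i, a i x ω y) (∑ i, A i) :=
  ⟨fun ω => continuous_finsetSum _ fun i _ => (ha i).1 ω,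
    fun x y => Finset.measurable_fun_sum _ fun i _ => (ha i).2.1 x y,
    fun x ω y k => Finset.sum_congr rfl fun i _ => (ha i).2.2.1 x ω y k, fun x ω y =>
      (Finset.abs_sum_le_sum_abs _ _).trans (Finset.sum_le_sum fun i _ => (ha i).2.2.2 x ω y)⟩

lemma adm_kv {N : ℕ} {Ω : Type*} [MeasurableSpace Ω] {Φ : ℝ → ℝ} (hΦ : IsYoung Φ) {c : ℝ} (hc : 0 < c)
    {f : (Fin N → ℝ) → Ω → (Fin N → ℝ) → (Fin N → ℝ) → ℝ} (h : Good Φ c f) {κ : (Fin N → ℝ) → ℝ}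
    (hκ : Continuous κ) (hs : HasCompactSupport κ) {M : ℝ} (hM : 0 ≤ M)
    {ξ : Fin N → (Fin N → ℝ) → Ω → (Fin N → ℝ) → ℝ} (hξ : ∀ j, Adm (ξ j) M) :
    ∃ K : ℝ, 0 ≤ K ∧ Adm (fun x ω y => Kv κ f x ω y (fun j => ξ j x ω y)) K := by
  obtain ⟨K, hK0, hK⟩ := kv_bound hΦ hc h hκ hs M
  refine ⟨K, hK0, fun ω => ?_, fun x y => ?_, fun x ω y k => ?_, fun x ω y => hK _ _ _ _ ?_⟩
  · have : Continuous fun q : (Fin N → ℝ) × (Fin N → ℝ) => (q.1, q.2, fun j => ξ j q.1 ω q.2) :=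
      continuous_fst.prodMk (continuous_snd.prodMk (continuous_pi fun j => (hξ j).1 ω))
    exact (kv_cont h hκ hs ω).comp this
  · have : Measurable fun ω => (((x, ω), y), fun j => ξ j x ω y) :=
      ((measurable_const.prodMk measurable_id).prodMk measurable_const).prodMk
        (measurable_pi_lambda _ fun j => (hξ j).2.1 x y)
    exact (good_meas4 (kv_cont h hκ hs) (kv_meas h hκ)).comp this
  · have : (fun j => ξ j x ω (y + fun i => (k i : ℝ))) = fun j => ξ j x ω y := by
      ext j; exact (hξ j).2.2.1 x ω y k
    beta_reduce; rw [this, kv_per h]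
  · rw [pi_norm_le_iff_of_nonneg hM]
    exact fun j => (hξ j).2.2.2 x ω y

/-- tangent functional -/
def Psi {N : ℕ} {Ω : Type*} (θ : (Fin N → ℝ) → ℝ)
    (f : (Fin N → ℝ) → Ω → (Fin N → ℝ) → (Fin N → ℝ) → ℝ)
    (x : Fin N → ℝ) (ω : Ω) (y ξ lam : Fin N → ℝ) : ℝ :=
  Kv θ f x ω y ξ + ∑ j, Kv (Dj θ j) f x ω y ξ * (lam j - ξ j)

lemma lower_one {N : ℕ} (hN : 1 ≤ N) {Ω : Type*} [MeasurableSpace Ω] (μ : Measure Ω)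
    [IsProbabilityMeasure μ] (Φ : ℝ → ℝ) (hΦ : IsYoung Φ)
    (T : (Fin N → ℝ) → Ω → Ω) (hT : IsDynSys μ T)
    (Q : Set (Fin N → ℝ)) (hQo : IsOpen Q) (hQb : Bornology.IsBounded Q)
    (f : (Fin N → ℝ) → Ω → (Fin N → ℝ) → (Fin N → ℝ) → ℝ) (c : ℝ) (hc : 0 < c) (hf : Good Φ c f)
    (ε : ℕ → ℝ) (hε : ∀ k, ε k ∈ Set.Ioc (0 : ℝ) 1) (hε0 : Tendsto ε atTop (nhds 0))
    (vk : ℕ → (Fin N → ℝ) → Ω → Fin N → ℝ)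
    (hvkmeas : ∀ k, Measurable fun p : (Fin N → ℝ) × Ω => vk k p.1 p.2)
    (C : ℝ) (hvki : ∀ k, Integrable (fun p => Φ (enorm2 (vk k p.1 p.2))) ((volume.restrict Q).prod μ))
    (hvkC : ∀ k, ∫ p, Φ (enorm2 (vk k p.1 p.2)) ∂((volume.restrict Q).prod μ) ≤ C)
    (v : (Fin N → ℝ) → Ω → (Fin N → ℝ) → Fin N → ℝ)
    (hvi : ∀ j, Integrable (fun p : ((Fin N → ℝ) × Ω) × (Fin N → ℝ) => v p.1.1 p.1.2 p.2 j)
      (((volume.restrict Q).prod μ).prod (volume.restrict (Ycube N))))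
    (hconv : ∀ j : Fin N, WeakStoch2Scale μ T Q ε
      (fun k x ω => vk k x ω j) (fun x ω y => v x ω y j))
    (A : ℝ) (hA0 : 0 ≤ A) (hA : ∀ t, 0 ≤ t → Φ (t + 1) ≤ A * (1 + Φ t))
    {θ : (Fin N → ℝ) → ℝ} (hθ : ContDiff ℝ (⊤ : ℕ∞) θ) (hs : HasCompactSupport θ)
    (h0 : ∀ η, 0 ≤ θ η) {n : ℕ} (hn : 1 ≤ n)
    (hsup : tsupport θ ⊆ {η : Fin N → ℝ | enorm2 η ≤ 1 / (n : ℝ)}) (h1 : (∫ η, θ η) = 1)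
    {M : ℝ} (hM : 0 ≤ M)
    {ξ : Fin N → (Fin N → ℝ) → Ω → (Fin N → ℝ) → ℝ} (hξ : ∀ j, Adm (ξ j) M) :
    (∫ p, Psi θ f p.1.1 p.1.2 p.2 (fun j => ξ j p.1.1 p.1.2 p.2) (v p.1.1 p.1.2 p.2)
      ∂(((volume.restrict Q).prod μ).prod (volume.restrict (Ycube N)))) -
      c * ((1 + A) * ((volume.restrict Q).prod μ).real Set.univ + A * C) / n ≤
     atTop.liminf (fun k => ∫ p,
          f p.1 (T ((ε k)⁻¹ • p.1) p.2) (((ε k) ^ 2)⁻¹ • p.1) (vk k p.1 p.2)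
          ∂((volume.restrict Q).prod μ)) := by
  have hQfin : IsFiniteMeasure (volume.restrict Q) := ⟨by simpa using hQb.measure_lt_top⟩
  have hYfin : IsFiniteMeasure (volume.restrict (Ycube N)) := ⟨by simp [ycube_vol]⟩
  set ν := (volume.restrict Q).prod μ with hν
  set σ := ν.prod (volume.restrict (Ycube N)) with hσ
  have hn0 : (0 : ℝ) < n := by exact_mod_cast hn
  obtain ⟨K, hK0, hKa⟩ := adm_kv hΦ hc hf hθ.continuous hs hM hξ
  choose L hL0 hLa using fun j => adm_kv hΦ hc hf (Dj_cont hθ j) (Dj_supp hs j) hM hξ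
  have hGa := adm_sub hKa (adm_sum fun j => adm_mul (hL0 j) (hLa j) (hξ j))
  set B : Fin N → (Fin N → ℝ) → Ω → (Fin N → ℝ) → ℝ :=
    fun j x ω y => Kv (Dj θ j) f x ω y (fun j => ξ j x ω y) with hB
  set G : (Fin N → ℝ) → Ω → (Fin N → ℝ) → ℝ :=
    fun x ω y => Kv θ f x ω y (fun j => ξ j x ω y) - ∑ j, B j x ω y * ξ j x ω y with hG
  set KG := K + ∑ j, L j * M with hKG
  have hKG0 : 0 ≤ KG := add_nonneg hK0 (Finset.sum_nonneg fun j _ => mul_nonneg (hL0 j) hM)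
  have hGa' : Adm G KG := hGa
  have hBa : ∀ j, Adm (B j) (L j) := hLa
  set τ : ℕ → (Fin N → ℝ) × Ω → ((Fin N → ℝ) × Ω) × (Fin N → ℝ) :=
    fun k p => ((p.1, T ((ε k)⁻¹ • p.1) p.2), ((ε k) ^ 2)⁻¹ • p.1) with hτ
  have τm : ∀ k, Measurable (τ k) := fun k =>
    (skew_mp μ T hT Q (ε k)⁻¹).measurable.prodMk (by fun_prop)
  have Φ0 : ∀ k (p : (Fin N → ℝ) × Ω), 0 ≤ Φ (enorm2 (vk k p.1 p.2)) := fun k p => hΦ.2.2.2.2.1 _ (enorm2_nonneg _)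
  have hUI : ∀ j, ∀ η : ℝ, 0 < η → ∃ R : ℝ, 0 ≤ R ∧ ∀ k (p : (Fin N → ℝ) × Ω), |vk k p.1 p.2 j| ≤ R + η * Φ (enorm2 (vk k p.1 p.2)) := by
    intro j η hη
    obtain ⟨R, hR0, hR⟩ := young_superlin hΦ η hη
    exact ⟨R, hR0, fun k p => (abs_le_enorm2 _ j).trans (hR _ (enorm2_nonneg _))⟩
  -- convergence
  have c1 := ext2s hN μ T hT Q hQo hQb ε (fun _ _ _ => 1) (fun _ => measurable_const)
    (fun _ _ => 0) (fun _ => integrable_zero _ _ _) (fun _ _ => le_rfl) 0 (fun _ => by simp)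
    (fun η _ => ⟨1, zero_le_one, fun k p => by simp⟩) (fun _ _ _ => 1) (integrable_const _)
    (const2s μ T hT Q ε hε hε0) G KG hKG0 hGa'
  have c2 := fun j => ext2s hN μ T hT Q hQo hQb ε (fun k x ω => vk k x ω j)
    (fun k => (measurable_pi_apply j).comp (hvkmeas k)) (fun k p => Φ (enorm2 (vk k p.1 p.2))) hvki Φ0 C hvkC
    (hUI j) (fun x ω y => v x ω y j) (hvi j) (hconv j) (B j) (L j) (hL0 j) (hBa j)
  have c3 := (c1.add (tendsto_finsetSum Finset.univ fun j _ => c2 j)).sub_const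
    (c * ((1 + A) * ν.real Set.univ + A * C) / n)
  have Gi : Integrable (fun p : ((Fin N → ℝ) × Ω) × (Fin N → ℝ) => 1 * G p.1.1 p.1.2 p.2) σ :=
    int_mul_bdd (integrable_const _) (cara_meas hGa'.1 hGa'.2.1) KG fun p => hGa'.2.2.2 _ _ _
  have Bi : ∀ j, Integrable (fun p : ((Fin N → ℝ) × Ω) × (Fin N → ℝ) => v p.1.1 p.1.2 p.2 j * B j p.1.1 p.1.2 p.2) σ := fun j =>
    int_mul_bdd (hvi j) (cara_meas (hBa j).1 (hBa j).2.1) (L j) fun p => (hBa j).2.2.2 _ _ _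
  have eL : (∫ p, Psi θ f p.1.1 p.1.2 p.2 (fun j => ξ j p.1.1 p.1.2 p.2) (v p.1.1 p.1.2 p.2) ∂σ) =
      ∫ p, 1 * G p.1.1 p.1.2 p.2 ∂σ + ∑ j, ∫ p, v p.1.1 p.1.2 p.2 j * B j p.1.1 p.1.2 p.2 ∂σ := by
    rw [← integral_finsetSum _ fun j _ => Bi j, ← integral_add Gi (integrable_finsetSum _ fun j _ => Bi j)]
    refine integral_congr_ae (Eventually.of_forall fun p => ?_)
    simp only [Psi, hG, hB, mul_sub, Finset.sum_sub_distrib, one_mul]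
    simp only [mul_comm]
    ring
  rw [eL]
  -- pointwise inequality
  have fm : ∀ k, Measurable fun p : (Fin N → ℝ) × Ω =>
      f p.1 (T ((ε k)⁻¹ • p.1) p.2) (((ε k) ^ 2)⁻¹ • p.1) (vk k p.1 p.2) := fun k =>
    (good_meas4 hf.1 hf.2.1).comp ((τm k).prodMk (hvkmeas k))
  have ubi : ∀ k, Integrable (fun p : (Fin N → ℝ) × Ω => c * (1 + Φ (enorm2 (vk k p.1 p.2)))) ν := fun k =>
    ((integrable_const 1).add (hvki k)).const_mul c
  have fi : ∀ k, Integrable (fun p : (Fin N → ℝ) × Ω =>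
      f p.1 (T ((ε k)⁻¹ • p.1) p.2) (((ε k) ^ 2)⁻¹ • p.1) (vk k p.1 p.2)) ν := fun k =>
    (ubi k).mono' (fm k).aestronglyMeasurable (Eventually.of_forall fun p => by
      rw [Real.norm_of_nonneg (hf.2.2.2.2 _ _ _ _).1]; exact (hf.2.2.2.2 _ _ _ _).2)
  have fub : ∀ k, ∫ p, f p.1 (T ((ε k)⁻¹ • p.1) p.2) (((ε k) ^ 2)⁻¹ • p.1) (vk k p.1 p.2) ∂ν ≤
      c * (ν.real Set.univ + C) := by
    intro k
    calc _ ≤ ∫ p, c * (1 + Φ (enorm2 (vk k p.1 p.2))) ∂ν :=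
          integral_mono (fi k) (ubi k) fun p => (hf.2.2.2.2 _ _ _ _).2
      _ = c * (ν.real Set.univ + ∫ p, Φ (enorm2 (vk k p.1 p.2)) ∂ν) := by
          rw [integral_const_mul, integral_add (integrable_const 1) (hvki k), integral_const]; simp
      _ ≤ _ := by gcongr; exact hvkC k
  have key : ∀ k, (∫ p, 1 * G p.1 (T ((ε k)⁻¹ • p.1) p.2) (((ε k) ^ 2)⁻¹ • p.1) ∂ν +
      ∑ j, ∫ p, vk k p.1 p.2 j * B j p.1 (T ((ε k)⁻¹ • p.1) p.2) (((ε k) ^ 2)⁻¹ • p.1) ∂ν) -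
        c * ((1 + A) * ν.real Set.univ + A * C) / n ≤
      ∫ p, f p.1 (T ((ε k)⁻¹ • p.1) p.2) (((ε k) ^ 2)⁻¹ • p.1) (vk k p.1 p.2) ∂ν := by
    intro k
    have j1 : Integrable (fun p : (Fin N → ℝ) × Ω => 1 * G p.1 (T ((ε k)⁻¹ • p.1) p.2) (((ε k) ^ 2)⁻¹ • p.1)) ν :=
      int_mul_bdd (integrable_const _) ((cara_meas hGa'.1 hGa'.2.1).comp (τm k)) KG fun p => hGa'.2.2.2 _ _ _
    have vki : ∀ j, Integrable (fun p : (Fin N → ℝ) × Ω => vk k p.1 p.2 j) ν := by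
      intro j
      obtain ⟨R, _, hR⟩ := hUI j 1 one_pos
      exact ((integrable_const R).add ((hvki k).const_mul 1)).mono'
        ((measurable_pi_apply j).comp (hvkmeas k)).aestronglyMeasurable
        (Eventually.of_forall fun p => hR k p)
    have j2 : ∀ j, Integrable (fun p : (Fin N → ℝ) × Ω => vk k p.1 p.2 j * B j p.1 (T ((ε k)⁻¹ • p.1) p.2) (((ε k) ^ 2)⁻¹ • p.1)) ν := fun j =>
      int_mul_bdd (vki j) ((cara_meas (hBa j).1 (hBa j).2.1).comp (τm k)) (L j) fun p => (hBa j).2.2.2 _ _ _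
    have j3 : Integrable (fun p : (Fin N → ℝ) × Ω => c / n * ((1 + A) + A * Φ (enorm2 (vk k p.1 p.2)))) ν :=
      ((integrable_const (1 + A)).add ((hvki k).const_mul A)).const_mul _
    have e3 : ∫ p, c / n * ((1 + A) + A * Φ (enorm2 (vk k p.1 p.2))) ∂ν ≤ c * ((1 + A) * ν.real Set.univ + A * C) / n := by
      rw [integral_const_mul, integral_add (integrable_const (1 + A)) ((hvki k).const_mul A), integral_const,
        integral_const_mul, smul_eq_mul, mul_comm (ν.real Set.univ)]
      have : c * ((1 + A) * ν.real Set.univ + A * C) / n = c / n * ((1 + A) * ν.real Set.univ + A * C) := by ring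
      rw [this]
      gcongr
      exact hvkC k
    have hsumi := integrable_finsetSum Finset.univ fun j _ => j2 j
    rw [← integral_finsetSum _ fun j _ => j2 j, ← integral_add j1 hsumi]
    have : ∫ p, ((1 * G p.1 (T ((ε k)⁻¹ • p.1) p.2) (((ε k) ^ 2)⁻¹ • p.1) +
        ∑ j, vk k p.1 p.2 j * B j p.1 (T ((ε k)⁻¹ • p.1) p.2) (((ε k) ^ 2)⁻¹ • p.1)) -
        c / n * ((1 + A) + A * Φ (enorm2 (vk k p.1 p.2)))) ∂ν ≤
        ∫ p, f p.1 (T ((ε k)⁻¹ • p.1) p.2) (((ε k) ^ 2)⁻¹ • p.1) (vk k p.1 p.2) ∂ν := by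
      refine integral_mono ((j1.add hsumi).sub j3) (fi k) fun p => ?_
      have q1 := kv_grad hf hθ hs h0 p.1 (T ((ε k)⁻¹ • p.1) p.2) (((ε k) ^ 2)⁻¹ • p.1) (vk k p.1 p.2)
        (fun j => ξ j p.1 (T ((ε k)⁻¹ • p.1) p.2) (((ε k) ^ 2)⁻¹ • p.1))
      have q2 := kv_upper hΦ hc hf hθ hs h0 hn hsup h1 A hA p.1 (T ((ε k)⁻¹ • p.1) p.2) (((ε k) ^ 2)⁻¹ • p.1) (vk k p.1 p.2)
      have q3 := q1.trans q2
      have q4 : c * (1 + A * (1 + Φ (enorm2 (vk k p.1 p.2)))) / n = c / n * ((1 + A) + A * Φ (enorm2 (vk k p.1 p.2))) := by ring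
      rw [q4] at q3
      simp only [hG, hB]
      simp only [mul_sub, Finset.sum_sub_distrib] at q3
      have q5 : ∑ j, vk k p.1 p.2 j * Kv (Dj θ j) f p.1 (T ((ε k)⁻¹ • p.1) p.2) (((ε k) ^ 2)⁻¹ • p.1)
          (fun j => ξ j p.1 (T ((ε k)⁻¹ • p.1) p.2) (((ε k) ^ 2)⁻¹ • p.1)) =
          ∑ j, Kv (Dj θ j) f p.1 (T ((ε k)⁻¹ • p.1) p.2) (((ε k) ^ 2)⁻¹ • p.1)
          (fun j => ξ j p.1 (T ((ε k)⁻¹ • p.1) p.2) (((ε k) ^ 2)⁻¹ • p.1)) * vk k p.1 p.2 j :=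
        Finset.sum_congr rfl fun j _ => mul_comm _ _
      rw [q5]
      linarith
    have hj : Integrable (fun p : (Fin N → ℝ) × Ω => 1 * G p.1 (T ((ε k)⁻¹ • p.1) p.2) (((ε k) ^ 2)⁻¹ • p.1) +
        ∑ j, vk k p.1 p.2 j * B j p.1 (T ((ε k)⁻¹ • p.1) p.2) (((ε k) ^ 2)⁻¹ • p.1)) ν := j1.add hsumi
    rw [integral_sub hj j3] at this
    linarith
  refine c3.liminf_eq.symm.le.trans (liminf_le_liminf (Eventually.of_forall key) c3.isBoundedUnder_ge ?_)
  exact (isBoundedUnder_of ⟨_, fub⟩ : IsBoundedUnder (· ≤ ·) atTop _).isCoboundedUnder_ge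


lemma psi_cont {N : ℕ} {Ω : Type*} [MeasurableSpace Ω] {Φ : ℝ → ℝ} {c : ℝ}
    {f : (Fin N → ℝ) → Ω → (Fin N → ℝ) → (Fin N → ℝ) → ℝ} (hf : Good Φ c f)
    {θ : (Fin N → ℝ) → ℝ} (hθ : ContDiff ℝ (⊤ : ℕ∞) θ) (hs : HasCompactSupport θ)
    (x : Fin N → ℝ) (ω : Ω) (y lam : Fin N → ℝ) : Continuous fun ξ => Psi θ f x ω y ξ lam := by
  have hl : Continuous fun ξ : Fin N → ℝ => (x, y, ξ) := by fun_prop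
  refine ((kv_cont hf hθ.continuous hs ω).comp hl).add (continuous_finsetSum _ fun j _ => ?_)
  exact ((kv_cont hf (Dj_cont hθ j) (Dj_supp hs j) ω).comp hl).mul (by fun_prop)

lemma psi_meas {N : ℕ} {Ω : Type*} [MeasurableSpace Ω] {Φ : ℝ → ℝ} {c : ℝ}
    {f : (Fin N → ℝ) → Ω → (Fin N → ℝ) → (Fin N → ℝ) → ℝ} (hf : Good Φ c f)
    {θ : (Fin N → ℝ) → ℝ} (hθ : ContDiff ℝ (⊤ : ℕ∞) θ) (hs : HasCompactSupport θ)
    {ξ lam : ((Fin N → ℝ) × Ω) × (Fin N → ℝ) → (Fin N → ℝ)} (hξ : Measurable ξ) (hl : Measurable lam) :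
    Measurable fun p => Psi θ f p.1.1 p.1.2 p.2 (ξ p) (lam p) := by
  have h4 : ∀ {κ : (Fin N → ℝ) → ℝ}, Continuous κ → HasCompactSupport κ →
      Measurable fun p => Kv κ f p.1.1 p.1.2 p.2 (ξ p) := fun h1 h2 =>
    (good_meas4 (kv_cont hf h1 h2) (kv_meas hf h1)).comp (measurable_id.prodMk hξ)
  refine (h4 hθ.continuous hs).add (Finset.measurable_fun_sum _ fun j _ => ?_)
  exact (h4 (Dj_cont hθ j) (Dj_supp hs j)).mul
    (((measurable_pi_apply j).comp hl).sub ((measurable_pi_apply j).comp hξ))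

lemma psi_limit {N : ℕ} {Ω : Type*} [MeasurableSpace Ω] (μ : Measure Ω)
    [IsProbabilityMeasure μ] (Φ : ℝ → ℝ) (hΦ : IsYoung Φ)
    (Q : Set (Fin N → ℝ)) (hQb : Bornology.IsBounded Q)
    (f : (Fin N → ℝ) → Ω → (Fin N → ℝ) → (Fin N → ℝ) → ℝ) (c : ℝ) (hc : 0 < c) (hf : Good Φ c f)
    (v : (Fin N → ℝ) → Ω → (Fin N → ℝ) → Fin N → ℝ)
    (hvmeas : Measurable fun p : ((Fin N → ℝ) × Ω) × (Fin N → ℝ) => v p.1.1 p.1.2 p.2)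
    (hvper : ∀ (x : Fin N → ℝ) (ω : Ω) (y : Fin N → ℝ) (k : Fin N → ℤ),
      v x ω (y + fun i => (k i : ℝ)) = v x ω y)
    (hvi : ∀ j, Integrable (fun p : ((Fin N → ℝ) × Ω) × (Fin N → ℝ) => v p.1.1 p.1.2 p.2 j)
      (((volume.restrict Q).prod μ).prod (volume.restrict (Ycube N))))
    {θ : (Fin N → ℝ) → ℝ} (hθ : ContDiff ℝ (⊤ : ℕ∞) θ) (hs : HasCompactSupport θ)
    (hKi : Integrable (fun p : ((Fin N → ℝ) × Ω) × (Fin N → ℝ) => Kv θ f p.1.1 p.1.2 p.2 (v p.1.1 p.1.2 p.2))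
      (((volume.restrict Q).prod μ).prod (volume.restrict (Ycube N))))
    (Z : ℝ) (hlow : ∀ (M : ℝ) (_ : 0 ≤ M) (ξ : Fin N → (Fin N → ℝ) → Ω → (Fin N → ℝ) → ℝ) (_ : ∀ j, Adm (ξ j) M),
      (∫ p, Psi θ f p.1.1 p.1.2 p.2 (fun j => ξ j p.1.1 p.1.2 p.2) (v p.1.1 p.1.2 p.2)
      ∂(((volume.restrict Q).prod μ).prod (volume.restrict (Ycube N)))) ≤ Z) :
    (∫ p, Kv θ f p.1.1 p.1.2 p.2 (v p.1.1 p.1.2 p.2)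
      ∂(((volume.restrict Q).prod μ).prod (volume.restrict (Ycube N)))) ≤ Z := by
  have hQfin : IsFiniteMeasure (volume.restrict Q) := ⟨by simpa using hQb.measure_lt_top⟩
  have hYfin : IsFiniteMeasure (volume.restrict (Ycube N)) := ⟨by simp [ycube_vol]⟩
  set σ := ((volume.restrict Q).prod μ).prod (volume.restrict (Ycube N)) with hσ
  -- truncation
  set vM : ℕ → ((Fin N → ℝ) × Ω) × (Fin N → ℝ) → (Fin N → ℝ) :=
    fun M p => if ‖v p.1.1 p.1.2 p.2‖ ≤ M then v p.1.1 p.1.2 p.2 else 0 with hvM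
  have vMm : ∀ M, Measurable (vM M) := fun M =>
    Measurable.ite (measurableSet_le hvmeas.norm measurable_const) hvmeas measurable_const
  have vMb : ∀ M p, ‖vM M p‖ ≤ M := by
    intro M p
    simp only [hvM]
    split_ifs with h
    · exact h
    · simp
  have step1 : ∀ M : ℕ, ∫ p, Psi θ f p.1.1 p.1.2 p.2 (vM M p) (v p.1.1 p.1.2 p.2) ∂σ ≤ Z := by
    intro M
    have hmol := fun j => mollify μ Q (fun x ω y => vM M ((x, ω), y) j)
      ((measurable_pi_apply j).comp (vMm M))
      (fun x ω y k => by simp only [hvM, hvper]) M (fun x ω y => (norm_le_pi_norm _ j).trans (vMb M _))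
    choose a ha hlim using hmol
    obtain ⟨K, hK0, hK⟩ := kv_bound hΦ hc hf hθ.continuous hs M
    choose L hL0 hL using fun j => kv_bound hΦ hc hf (Dj_cont hθ j) (Dj_supp hs j) M
    refine le_of_tendsto (tendsto_integral_of_dominated_convergence
      (F := fun m p => Psi θ f p.1.1 p.1.2 p.2 (fun j => a j m p.1.1 p.1.2 p.2) (v p.1.1 p.1.2 p.2))
      (fun p => K + ∑ j, L j * (|v p.1.1 p.1.2 p.2 j| + M)) (fun m => ?_) ?_ (fun m => ?_) ?_)
      (Eventually.of_forall fun m => hlow M (Nat.cast_nonneg _) (fun j => a j m) fun j => ha j m)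
    · exact (psi_meas hf hθ hs (measurable_pi_lambda _ fun j => cara_meas (ha j m).1 (ha j m).2.1) hvmeas).aestronglyMeasurable
    · exact (integrable_const K).add (integrable_finsetSum _ fun j _ =>
        ((hvi j).abs.add (integrable_const _)).const_mul _)
    · refine Eventually.of_forall fun p => ?_
      have hn : ‖fun j => a j m p.1.1 p.1.2 p.2‖ ≤ M := by
        rw [pi_norm_le_iff_of_nonneg (Nat.cast_nonneg _)]
        exact fun j => (ha j m).2.2.2 _ _ _
      rw [Real.norm_eq_abs, Psi]
      refine (abs_add_le _ _).trans (add_le_add (hK _ _ _ _ hn) ((Finset.abs_sum_le_sum_abs _ _).trans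
        (Finset.sum_le_sum fun j _ => ?_)))
      rw [abs_mul]
      exact mul_le_mul (hL j _ _ _ _ hn) ((abs_sub _ _).trans (add_le_add le_rfl ((ha j m).2.2.2 _ _ _)))
        (abs_nonneg _) (hL0 j)
    · filter_upwards [ae_all_iff.2 hlim] with p hp
      refine ((psi_cont hf hθ hs _ _ _ _).tendsto (vM M p)).comp ?_
      rw [tendsto_pi_nhds]
      exact hp
  obtain ⟨K, hK0, hK⟩ := kv_bound hΦ hc hf hθ.continuous hs 0
  choose L hL0 hL using fun j => kv_bound hΦ hc hf (Dj_cont hθ j) (Dj_supp hs j) 0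
  refine le_of_tendsto (tendsto_integral_of_dominated_convergence
    (F := fun (M : ℕ) p => Psi θ f p.1.1 p.1.2 p.2 (vM M p) (v p.1.1 p.1.2 p.2))
    (fun p => |Kv θ f p.1.1 p.1.2 p.2 (v p.1.1 p.1.2 p.2)| + (K + ∑ j, L j * |v p.1.1 p.1.2 p.2 j|))
    (fun m => ?_) ?_ (fun m => ?_) ?_) (Eventually.of_forall step1)
  · exact (psi_meas hf hθ hs (vMm m) hvmeas).aestronglyMeasurable
  · exact hKi.abs.add ((integrable_const K).add (integrable_finsetSum _ fun j _ => (hvi j).abs.const_mul _))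
  · refine Eventually.of_forall fun p => ?_
    have hR : 0 ≤ K + ∑ j, L j * |v p.1.1 p.1.2 p.2 j| :=
      add_nonneg hK0 (Finset.sum_nonneg fun j _ => mul_nonneg (hL0 j) (abs_nonneg _))
    simp only [hvM]
    split_ifs with h
    · simp only [Psi, sub_self, mul_zero, Finset.sum_const_zero, add_zero, Real.norm_eq_abs]
      linarith
    · rw [Real.norm_eq_abs, Psi]
      have hn : ‖(0 : Fin N → ℝ)‖ ≤ 0 := by simp
      refine le_trans ((abs_add_le _ _).trans (add_le_add (hK _ _ _ _ hn) ((Finset.abs_sum_le_sum_abs _ _).trans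
        (Finset.sum_le_sum fun j _ => ?_)))) (le_add_of_nonneg_left (abs_nonneg _))
      rw [abs_mul]
      simp only [Pi.zero_apply, sub_zero]
      exact mul_le_mul_of_nonneg_right (hL j _ _ _ _ hn) (abs_nonneg _)
  · refine Eventually.of_forall fun p => ?_
    obtain ⟨M0, hM0⟩ := exists_nat_ge ‖v p.1.1 p.1.2 p.2‖
    refine tendsto_const_nhds.congr' ?_
    filter_upwards [eventually_ge_atTop M0] with M hM
    have : ‖v p.1.1 p.1.2 p.2‖ ≤ M := hM0.trans (by exact_mod_cast hM)
    simp only [hvM, if_pos this, Psi, sub_self, mul_zero, Finset.sum_const_zero, add_zero]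

lemma main_good {N : ℕ} (hN : 1 ≤ N) {Ω : Type*} [MeasurableSpace Ω] (μ : Measure Ω)
    [IsProbabilityMeasure μ] 
    (Φ : ℝ → ℝ) (hΦ : IsYoung Φ) (hΦ2 : Delta2 Φ)
    (T : (Fin N → ℝ) → Ω → Ω) (hT : IsDynSys μ T)
    (Q : Set (Fin N → ℝ)) (hQo : IsOpen Q) (hQb : Bornology.IsBounded Q)
    (f : (Fin N → ℝ) → Ω → (Fin N → ℝ) → (Fin N → ℝ) → ℝ) (c : ℝ) (hc : 0 < c) (hf : Good Φ c f)
    (θ : ℕ → (Fin N → ℝ) → ℝ)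
    (hθ : ∀ n : ℕ, 1 ≤ n → ContDiff ℝ (⊤ : ℕ∞) (θ n) ∧ HasCompactSupport (θ n) ∧
      (∀ η, 0 ≤ θ n η) ∧ tsupport (θ n) ⊆ {η : Fin N → ℝ | enorm2 η ≤ 1 / (n : ℝ)} ∧
      (∫ η, θ n η) = 1)
    (ε : ℕ → ℝ) (hε : ∀ k, ε k ∈ Set.Ioc (0 : ℝ) 1) (hε0 : Tendsto ε atTop (nhds 0))
    (vk : ℕ → (Fin N → ℝ) → Ω → Fin N → ℝ)
    (hvkmeas : ∀ k, Measurable fun p : (Fin N → ℝ) × Ω => vk k p.1 p.2)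
    (hvkbd : (⨆ k, luxNorm Φ ((volume.restrict Q).prod μ)
      fun p => enorm2 (vk k p.1 p.2)) < ⊤)
    (v : (Fin N → ℝ) → Ω → (Fin N → ℝ) → Fin N → ℝ)
    (hvmeas : Measurable fun p : ((Fin N → ℝ) × Ω) × (Fin N → ℝ) => v p.1.1 p.1.2 p.2)
    (hvper : ∀ (x : Fin N → ℝ) (ω : Ω) (y : Fin N → ℝ) (k : Fin N → ℤ),
      v x ω (y + fun i => (k i : ℝ)) = v x ω y)
    (hvbd : luxNorm Φ (((volume.restrict Q).prod μ).prod (volume.restrict (Ycube N)))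
      (fun p => enorm2 (v p.1.1 p.1.2 p.2)) < ⊤)
    (hconv : ∀ j : Fin N, WeakStoch2Scale μ T Q ε
      (fun k x ω => vk k x ω j) (fun x ω y => v x ω y j)) :
    ∃ C' : ℝ, 0 ≤ C' ∧ ∀ n : ℕ, 1 ≤ n →
      (∫ p, (∫ η, θ n η * f p.1.1 p.1.2 p.2 (v p.1.1 p.1.2 p.2 - η))
          ∂(((volume.restrict Q).prod μ).prod (volume.restrict (Ycube N)))) - C' / (n : ℝ) ≤
        atTop.liminf (fun k => ∫ p,
          f p.1 (T ((ε k)⁻¹ • p.1) p.2) (((ε k) ^ 2)⁻¹ • p.1) (vk k p.1 p.2)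
          ∂((volume.restrict Q).prod μ)) := by
  have hQfin : IsFiniteMeasure (volume.restrict Q) := ⟨by simpa using hQb.measure_lt_top⟩
  have hYfin : IsFiniteMeasure (volume.restrict (Ycube N)) := ⟨by simp [ycube_vol]⟩
  obtain ⟨A, hA0, hA⟩ := delta2_shift hΦ hΦ2
  obtain ⟨C, hC0, hC⟩ := lux_bound hΦ hΦ2 ((volume.restrict Q).prod μ) _ hvkbd
  obtain ⟨C1, hC10, hC1⟩ := lux_bound hΦ hΦ2 (((volume.restrict Q).prod μ).prod (volume.restrict (Ycube N))) _ hvbd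
  have hk := fun k => hC (fun p => enorm2 (vk k p.1 p.2)) (enorm2_cont.measurable.comp (hvkmeas k))
    (fun _ => enorm2_nonneg _) (le_iSup (fun k => luxNorm Φ ((volume.restrict Q).prod μ)
      fun p => enorm2 (vk k p.1 p.2)) k)
  have hv := (hC1 (fun p => enorm2 (v p.1.1 p.1.2 p.2)) (enorm2_cont.measurable.comp hvmeas)
    (fun _ => enorm2_nonneg _) le_rfl).1
  have hvi : ∀ j, Integrable (fun p : ((Fin N → ℝ) × Ω) × (Fin N → ℝ) => v p.1.1 p.1.2 p.2 j)
      (((volume.restrict Q).prod μ).prod (volume.restrict (Ycube N))) := by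
    intro j
    obtain ⟨R, hR0, hR⟩ := young_superlin hΦ 1 one_pos
    exact ((integrable_const R).add (hv.const_mul 1)).mono' ((measurable_pi_apply j).comp hvmeas).aestronglyMeasurable
      (Eventually.of_forall fun p => (abs_le_enorm2 _ j).trans (hR _ (enorm2_nonneg _)))
  refine ⟨c * ((1 + A) * ((volume.restrict Q).prod μ).real Set.univ + A * C), by positivity, fun n hn => ?_⟩
  obtain ⟨t1, t2, t3, t4, t5⟩ := hθ n hn
  rw [sub_le_iff_le_add]
  refine psi_limit μ Φ hΦ Q hQb f c hc hf v hvmeas hvper hvi t1 t2 ?_ _ fun M hM ξ hξ => ?_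
  · have hb : Integrable (fun p : ((Fin N → ℝ) × Ω) × (Fin N → ℝ) => c * (1 + Φ (enorm2 (v p.1.1 p.1.2 p.2))) +
        c / n * (1 + A * (1 + Φ (enorm2 (v p.1.1 p.1.2 p.2)))))
        (((volume.restrict Q).prod μ).prod (volume.restrict (Ycube N))) :=
      (((integrable_const 1).add hv).const_mul c).add
        (((integrable_const 1).add (((integrable_const 1).add hv).const_mul A)).const_mul _)
    refine hb.mono' ?_ (Eventually.of_forall fun p => ?_)
    · exact ((good_meas4 (kv_cont hf t1.continuous t2) (kv_meas hf t1.continuous)).comp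
        (measurable_id.prodMk hvmeas)).aestronglyMeasurable
    · rw [Real.norm_of_nonneg (kv_nonneg hf t3 _ _ _ _)]
      refine (kv_upper hΦ hc hf t1 t2 t3 hn t4 t5 A hA _ _ _ _).trans (add_le_add (hf.2.2.2.2 _ _ _ _).2 (le_of_eq ?_))
      ring
  · have := lower_one hN μ Φ hΦ T hT Q hQo hQb f c hc hf ε hε hε0 vk hvkmeas C (fun k => (hk k).1) (fun k => (hk k).2)
      v hvi hconv A hA0 hA t1 t2 t3 hn t4 t5 hM hξ
    linarith

theorem stmt9 {N : ℕ} (hN : 1 ≤ N) {Ω : Type*} [MeasurableSpace Ω] (μ : Measure Ω)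
    [IsProbabilityMeasure μ] (hgen : CountGenModNull μ)
    (Φ : ℝ → ℝ) (hΦ : IsYoung Φ) (hΦ2 : Delta2 Φ) (hΦ2' : DeltaPrime Φ)
    (hΦc2 : Delta2 (conjY Φ)) (hΦc2' : DeltaPrime (conjY Φ))
    (T : (Fin N → ℝ) → Ω → Ω) (hT : IsDynSys μ T)
    (Q : Set (Fin N → ℝ)) (hQo : IsOpen Q) (hQb : Bornology.IsBounded Q)
    (f : (Fin N → ℝ) → Ω → (Fin N → ℝ) → (Fin N → ℝ) → ℝ)
    (hfmeas : ∀ x lam : Fin N → ℝ, Measurable fun p : Ω × (Fin N → ℝ) => f x p.1 p.2 lam)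
    (hfcont : ∀ᵐ ω ∂μ, Continuous fun q : (Fin N → ℝ) × (Fin N → ℝ) × (Fin N → ℝ) =>
      f q.1 ω q.2.1 q.2.2)
    (hH1 : ∃ ϖ : ℝ → ℝ, Continuous ϖ ∧ ϖ 0 = 0 ∧ (∀ t, 0 ≤ ϖ t) ∧
      ∃ a : (Fin N → ℝ) → ℝ, LocallyIntegrable a volume ∧
        ∀ᵐ p ∂(μ.prod (volume : Measure (Fin N → ℝ))), ∀ x x' lam : Fin N → ℝ,
          |f x p.1 p.2 lam - f x' p.1 p.2 lam| ≤ ϖ (enorm2 (x - x')) * (a p.2 + f x p.1 p.2 lam))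
    (hH2 : ∀ᵐ p ∂(μ.prod (volume : Measure (Fin N → ℝ))), ∀ x : Fin N → ℝ,
      StrictConvexOn ℝ Set.univ (f x p.1 p.2))
    (c₁ c₂ : ℝ) (hc₁ : 0 < c₁) (hc₂ : 0 < c₂)
    (hH3 : ∀ᵐ p ∂(μ.prod (volume : Measure (Fin N → ℝ))), ∀ x lam : Fin N → ℝ,
      c₁ * Φ (enorm2 lam) ≤ f x p.1 p.2 lam ∧ f x p.1 p.2 lam ≤ c₂ * (1 + Φ (enorm2 lam)))
    (hH4 : ∀ᵐ ω ∂μ, ∀ (x y lam : Fin N → ℝ) (k : Fin N → ℤ),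
      f x ω (y + fun i => (k i : ℝ)) lam = f x ω y lam)
    (θ : ℕ → (Fin N → ℝ) → ℝ)
    (hθ : ∀ n : ℕ, 1 ≤ n → ContDiff ℝ (⊤ : ℕ∞) (θ n) ∧ HasCompactSupport (θ n) ∧
      (∀ η, 0 ≤ θ n η) ∧ tsupport (θ n) ⊆ {η : Fin N → ℝ | enorm2 η ≤ 1 / (n : ℝ)} ∧
      (∫ η, θ n η) = 1)
    (ε : ℕ → ℝ) (hε : ∀ k, ε k ∈ Set.Ioc (0 : ℝ) 1) (hε0 : Tendsto ε atTop (nhds 0))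
    (vk : ℕ → (Fin N → ℝ) → Ω → Fin N → ℝ)
    (hvkmeas : ∀ k, Measurable fun p : (Fin N → ℝ) × Ω => vk k p.1 p.2)
    (hvkbd : (⨆ k, luxNorm Φ ((volume.restrict Q).prod μ)
      fun p => enorm2 (vk k p.1 p.2)) < ⊤)
    (v : (Fin N → ℝ) → Ω → (Fin N → ℝ) → Fin N → ℝ)
    (hvmeas : Measurable fun p : ((Fin N → ℝ) × Ω) × (Fin N → ℝ) => v p.1.1 p.1.2 p.2)
    (hvper : ∀ (x : Fin N → ℝ) (ω : Ω) (y : Fin N → ℝ) (k : Fin N → ℤ),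
      v x ω (y + fun i => (k i : ℝ)) = v x ω y)
    (hvbd : luxNorm Φ (((volume.restrict Q).prod μ).prod (volume.restrict (Ycube N)))
      (fun p => enorm2 (v p.1.1 p.1.2 p.2)) < ⊤)
    (hconv : ∀ j : Fin N, WeakStoch2Scale μ T Q ε
      (fun k x ω => vk k x ω j) (fun x ω y => v x ω y j)) :
    ∃ C' : ℝ, 0 ≤ C' ∧ ∀ n : ℕ, 1 ≤ n →
      (∫ p, (∫ η, θ n η * f p.1.1 p.1.2 p.2 (v p.1.1 p.1.2 p.2 - η))
          ∂(((volume.restrict Q).prod μ).prod (volume.restrict (Ycube N)))) - C' / (n : ℝ) ≤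
        atTop.liminf (fun k => ∫ p,
          f p.1 (T ((ε k)⁻¹ • p.1) p.2) (((ε k) ^ 2)⁻¹ • p.1) (vk k p.1 p.2)
          ∂((volume.restrict Q).prod μ)) := by
  have hall : ∀ᵐ ω ∂μ, (Continuous fun q : (Fin N → ℝ) × (Fin N → ℝ) × (Fin N → ℝ) => f q.1 ω q.2.1 q.2.2) ∧
      (∀ (x y lam : Fin N → ℝ) (k : Fin N → ℤ), f x ω (y + fun i => (k i : ℝ)) lam = f x ω y lam) ∧
      (∀ x y, ConvexOn ℝ Set.univ (f x ω y)) ∧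
      ∀ x y lam, 0 ≤ f x ω y lam ∧ f x ω y lam ≤ c₂ * (1 + Φ (enorm2 lam)) := by
    filter_upwards [hfcont, hH4, Measure.ae_ae_of_ae_prod hH2, Measure.ae_ae_of_ae_prod hH3] with ω h1 h4 h2 h3
    have hfc : ∀ x lam, Continuous fun y => f x ω y lam := fun x lam =>
      h1.comp (by fun_prop : Continuous fun y : Fin N → ℝ => (x, y, lam))
    refine ⟨h1, h4, fun x y => ⟨convex_univ, fun l _ l' _ a b ha hb hab => ?_⟩, fun x y lam => ?_⟩
    · have hcl : IsClosed {y | f x ω y (a • l + b • l') ≤ a • f x ω y l + b • f x ω y l'} :=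
        isClosed_le (hfc _ _) (((hfc x l).const_smul a).add ((hfc x l').const_smul b))
      have hd := Measure.dense_of_ae (h2.mono fun y hy =>
        ((hy x).convexOn.2 (Set.mem_univ l) (Set.mem_univ l') ha hb hab :
          f x ω y (a • l + b • l') ≤ a • f x ω y l + b • f x ω y l'))
      exact (hcl.closure_eq ▸ hd y :)
    · have hcl : IsClosed {y | 0 ≤ f x ω y lam ∧ f x ω y lam ≤ c₂ * (1 + Φ (enorm2 lam))} :=
        (isClosed_le continuous_const (hfc _ _)).inter (isClosed_le (hfc _ _) continuous_const)
      have hd := Measure.dense_of_ae (h3.mono fun y hy =>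
        (⟨(mul_nonneg hc₁.le (hΦ.2.2.2.2.1 _ (enorm2_nonneg lam))).trans (hy x lam).1, (hy x lam).2⟩ :
          0 ≤ f x ω y lam ∧ f x ω y lam ≤ c₂ * (1 + Φ (enorm2 lam))))
      exact (hcl.closure_eq ▸ hd y :)
  obtain ⟨S, hS, hSm, hSp⟩ := hall.exists_measurable_mem
  classical
  let g : (Fin N → ℝ) → Ω → (Fin N → ℝ) → (Fin N → ℝ) → ℝ := fun x ω y lam => if ω ∈ S then f x ω y lam else 0
  have hgS : ∀ x ω y lam, ω ∈ S → g x ω y lam = f x ω y lam := fun x ω y lam h => if_pos h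
  have hgood : Good Φ c₂ g := by
    refine ⟨fun ω => ?_, fun x y lam => ?_, fun x ω y lam k => ?_, fun x ω y => ?_, fun x ω y lam => ?_⟩
    · by_cases h : ω ∈ S
      · simpa [g, h] using (hSp ω h).1
      · simpa [g, h] using continuous_const
    · exact Measurable.ite hSm ((hfmeas x lam).comp (by fun_prop : Measurable fun ω : Ω => (ω, y))) measurable_const
    · by_cases h : ω ∈ S
      · simpa [g, h] using (hSp ω h).2.1 x y lam k
      · simp [g, h]
    · by_cases h : ω ∈ S
      · have : g x ω y = f x ω y := funext fun lam => hgS x ω y lam h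
        rw [this]; exact (hSp ω h).2.2.1 x y
      · have : g x ω y = fun _ => 0 := funext fun lam => if_neg h
        rw [this]; exact convexOn_const 0 convex_univ
    · by_cases h : ω ∈ S
      · rw [hgS x ω y lam h]; exact (hSp ω h).2.2.2 x y lam
      · have : g x ω y lam = 0 := if_neg h
        rw [this]
        exact ⟨le_rfl, mul_nonneg hc₂.le (add_nonneg zero_le_one (hΦ.2.2.2.2.1 _ (enorm2_nonneg lam)))⟩
  have hSν : ∀ᵐ p ∂((volume.restrict Q).prod μ), p.2 ∈ S := Measure.quasiMeasurePreserving_snd.ae hS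
  have hSσ : ∀ᵐ p ∂(((volume.restrict Q).prod μ).prod (volume.restrict (Ycube N))), p.1.2 ∈ S :=
    Measure.quasiMeasurePreserving_fst.ae hSν
  obtain ⟨C', hC0, hC⟩ := main_good hN μ Φ hΦ hΦ2 T hT Q hQo hQb g c₂ hc₂ hgood θ hθ ε hε hε0 vk hvkmeas hvkbd
    v hvmeas hvper hvbd hconv
  refine ⟨C', hC0, fun n hn => ?_⟩
  have h := hC n hn
  have e1 : (∫ p, (∫ η, θ n η * g p.1.1 p.1.2 p.2 (v p.1.1 p.1.2 p.2 - η))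
      ∂(((volume.restrict Q).prod μ).prod (volume.restrict (Ycube N)))) =
      ∫ p, (∫ η, θ n η * f p.1.1 p.1.2 p.2 (v p.1.1 p.1.2 p.2 - η))
      ∂(((volume.restrict Q).prod μ).prod (volume.restrict (Ycube N))) := by
    refine integral_congr_ae ?_
    filter_upwards [hSσ] with p hp
    simp only [hgS _ _ _ _ hp]
  have e2 : (fun k => ∫ p, g p.1 (T ((ε k)⁻¹ • p.1) p.2) (((ε k) ^ 2)⁻¹ • p.1) (vk k p.1 p.2)
      ∂((volume.restrict Q).prod μ)) =
      fun k => ∫ p, f p.1 (T ((ε k)⁻¹ • p.1) p.2) (((ε k) ^ 2)⁻¹ • p.1) (vk k p.1 p.2)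
      ∂((volume.restrict Q).prod μ) := by
    funext k
    refine integral_congr_ae ?_
    filter_upwards [(skew_mp μ T hT Q (ε k)⁻¹).quasiMeasurePreserving.ae hSν] with p hp
    exact hgS _ _ _ _ hp
  rw [e1, e2] at h
  exact h
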